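/- arXiv:1212.2648 — 5 statements merged into one kernel-verified Lean document; each statement's English description precedes it below -/
import Mathlib

section
/- The set of Kronecker product strings L₁ ⊗ ⋯ ⊗ L_N of 2×2 real matrices with each L_j ∈ {I, X, Z, Ỹ} and an odd number of factors equal to Ỹ is a basis over ℝ of the real vector space of antisymmetric 2^N × 2^N real matrices (the Lie algebra so(2^N)). -/
open Matrix

noncomputable section

/-- The real matrices `I, X, Z, Ỹ`, indexed by `Fin 4` (with `Ỹ` at index `3`). -/
def realPauli (i : Fin 4) : Matrix (Fin 2) (Fin 2) ℝ :=
  if i = 0 then 1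
  else if i = 1 then !![0, 1; 1, 0]
  else if i = 2 then !![1, 0; 0, -1]
  else !![0, 1; -1, 0]

/-- The `N`-fold Kronecker/tensor product `L₁ ⊗ ⋯ ⊗ L_N` of `2×2` real matrices, realized as a
`2^N × 2^N` matrix indexed by bit strings `Fin N → Fin 2`. -/
def tensorString {N : ℕ} (M : Fin N → Matrix (Fin 2) (Fin 2) ℝ) :
    Matrix (Fin N → Fin 2) (Fin N → Fin 2) ℝ :=
  Matrix.of fun r c => ∏ j, M j (r j) (c j)

theorem sum_realPauli_mul_realPauli (i k : Fin 4) :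
    ∑ a, ∑ b, realPauli i a b * realPauli k a b = if i = k then 2 else 0 := by
  fin_cases i <;> fin_cases k <;> norm_num +decide [realPauli, Fin.sum_univ_two, Matrix.one_apply]

theorem sum_realPauli_apply_mul_realPauli_apply (a b a' b' : Fin 2) :
    ∑ i, realPauli i a b * realPauli i a' b' = if a = a' ∧ b = b' then 2 else 0 := by
  fin_cases a <;> fin_cases b <;> fin_cases a' <;> fin_cases b' <;>
    norm_num +decide [realPauli, Fin.sum_univ_four, Matrix.one_apply]

theorem realPauli_apply_swap (i : Fin 4) (a b : Fin 2) :
    realPauli i b a = (if i = 3 then -1 else 1) * realPauli i a b := by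
  fin_cases i <;> fin_cases a <;> fin_cases b <;> norm_num +decide [realPauli, Matrix.one_apply]

/-- The tensor strings of `I, X, Z, Ỹ` are orthogonal for the entrywise inner product. -/
theorem sum_tensorString_mul_tensorString {N : ℕ} (f g : Fin N → Fin 4) :
    ∑ r, ∑ c, tensorString (fun j => realPauli (f j)) r c *
      tensorString (fun j => realPauli (g j)) r c = if f = g then 2 ^ N else 0 := by
  have h : ∏ j, ∑ a, ∑ b, realPauli (f j) a b * realPauli (g j) a b =
      if f = g then (2 : ℝ) ^ N else 0 := by
    simp only [sum_realPauli_mul_realPauli, Fintype.prod_ite_zero, funext_iff]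
    simp
  rw [← h]
  simp only [Finset.prod_univ_sum, Fintype.piFinset_univ, tensorString, Matrix.of_apply,
    Finset.prod_mul_distrib]

/-- The tensor strings of `I, X, Z, Ỹ` satisfy the completeness relation. -/
theorem sum_tensorString_apply_mul_tensorString_apply {N : ℕ} (r c r' c' : Fin N → Fin 2) :
    ∑ f : Fin N → Fin 4, tensorString (fun j => realPauli (f j)) r c *
      tensorString (fun j => realPauli (f j)) r' c' = if r = r' ∧ c = c' then 2 ^ N else 0 := by
  have h : ∏ j, ∑ i, realPauli i (r j) (c j) * realPauli i (r' j) (c' j) =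
      if r = r' ∧ c = c' then (2 : ℝ) ^ N else 0 := by
    simp only [sum_realPauli_apply_mul_realPauli_apply, Fintype.prod_ite_zero, funext_iff,
      forall_and]
    simp
  rw [← h]
  simp only [Finset.prod_univ_sum, Fintype.piFinset_univ, tensorString, Matrix.of_apply,
    Finset.prod_mul_distrib]

theorem tensorString_realPauli_apply_swap {N : ℕ} (f : Fin N → Fin 4) (r c : Fin N → Fin 2) :
    tensorString (fun j => realPauli (f j)) c r =
      (-1) ^ (Finset.univ.filter fun j => f j = 3).card *
        tensorString (fun j => realPauli (f j)) r c := by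
  simp only [tensorString, Matrix.of_apply]
  rw [Finset.prod_congr rfl fun j _ => realPauli_apply_swap (f j) (r j) (c j),
    Finset.prod_mul_distrib]
  simp [Finset.prod_ite]

/-- The entrywise inner product of an antisymmetric matrix with a string containing an even number
of factors `Ỹ` vanishes. -/
theorem sum_mul_tensorString_eq_zero {N : ℕ} {A : Matrix (Fin N → Fin 2) (Fin N → Fin 2) ℝ}
    (hA : Aᵀ = -A) {f : Fin N → Fin 4}
    (hf : ¬ Odd (Finset.univ.filter fun j => f j = 3).card) :
    ∑ r, ∑ c, A r c * tensorString (fun j => realPauli (f j)) r c = 0 := by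
  have hswap (r c : Fin N → Fin 2) : A c r * tensorString (fun j => realPauli (f j)) c r =
      -(A r c * tensorString (fun j => realPauli (f j)) r c) := by
    have hrc : A c r = -A r c := congrFun (congrFun hA r) c
    rw [tensorString_realPauli_apply_swap f r c, (Nat.not_odd_iff_even.mp hf).neg_one_pow, hrc]
    ring
  have h : ∑ r, ∑ c, A r c * tensorString (fun j => realPauli (f j)) r c =
      -∑ r, ∑ c, A r c * tensorString (fun j => realPauli (f j)) r c := by
    simp only [← Finset.sum_neg_distrib, ← hswap]
    exact Finset.sum_comm
  linarith

/-- Expansion of a matrix in the tensor strings of `I, X, Z, Ỹ`. -/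
theorem eq_sum_smul_tensorString {N : ℕ} (A : Matrix (Fin N → Fin 2) (Fin N → Fin 2) ℝ) :
    A = ∑ f : Fin N → Fin 4,
      ((2 ^ N)⁻¹ * ∑ r, ∑ c, A r c * tensorString (fun j => realPauli (f j)) r c) •
        tensorString (fun j => realPauli (f j)) := by
  ext r' c'
  simp only [Matrix.sum_apply, Matrix.smul_apply, smul_eq_mul, mul_assoc, Finset.sum_mul]
  rw [← Finset.mul_sum, Finset.sum_comm,
    Finset.sum_congr rfl fun _ _ => Finset.sum_comm]
  simp_rw [← Finset.mul_sum, sum_tensorString_apply_mul_tensorString_apply]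
  simp [ite_and, mul_comm]

theorem linearIndependent_tensorString_realPauli (N : ℕ) :
    LinearIndependent ℝ
      (fun f : Fin N → Fin 4 => tensorString fun j => realPauli (f j)) := by
  rw [Fintype.linearIndependent_iff]
  intro w hw g
  have h : ∑ r, ∑ c, (∑ f, w f • tensorString fun j => realPauli (f j)) r c *
      tensorString (fun j => realPauli (g j)) r c = w g * 2 ^ N := by
    simp only [Matrix.sum_apply, Matrix.smul_apply, smul_eq_mul, mul_assoc, Finset.sum_mul]
    simp_rw [Finset.sum_comm (t := (Finset.univ : Finset (Fin N → Fin 4))), ← Finset.mul_sum,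
      sum_tensorString_mul_tensorString]
    simp
  rw [hw] at h
  simpa using h.symm

/-- The Kronecker product strings `L₁ ⊗ ⋯ ⊗ L_N`, `L_j ∈ {I, X, Z, Ỹ}`, with an odd number of
factors `Ỹ` form an `ℝ`-basis of the antisymmetric `2^N × 2^N` real matrices (the Lie algebra
`so(2^N)`): the family is linearly independent and its span equals the space of antisymmetric
matrices. -/
theorem odd_Ytilde_strings_basis_of_so (N : ℕ) :
    LinearIndependent ℝ
      (fun f : {f : Fin N → Fin 4 // Odd (Finset.univ.filter fun j => f j = 3).card} =>
        tensorString fun j => realPauli (f.1 j)) ∧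
    (Submodule.span ℝ (Set.range
        (fun f : {f : Fin N → Fin 4 // Odd (Finset.univ.filter fun j => f j = 3).card} =>
          tensorString fun j => realPauli (f.1 j))) :
          Set (Matrix (Fin N → Fin 2) (Fin N → Fin 2) ℝ))
      = {A | Aᵀ = -A} := by
  refine ⟨(linearIndependent_tensorString_realPauli N).comp _ Subtype.val_injective, ?_⟩
  ext A
  simp only [SetLike.mem_coe, Set.mem_ofPred_eq]
  constructor
  · intro h
    induction h using Submodule.span_induction with
    | mem A hA =>
      obtain ⟨f, rfl⟩ := hA
      ext r c
      simp [tensorString_realPauli_apply_swap f.1 r c, f.2.neg_one_pow]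
    | zero => simp
    | add A B _ _ hA hB => rw [Matrix.transpose_add, hA, hB, neg_add]
    | smul a A _ hA => rw [Matrix.transpose_smul, hA, smul_neg]
  · intro hA
    rw [eq_sum_smul_tensorString A]
    refine Submodule.sum_mem _ fun f _ => ?_
    by_cases hf : Odd (Finset.univ.filter fun j => f j = 3).card
    · exact Submodule.smul_mem _ _ (Submodule.subset_span ⟨⟨f, hf⟩, rfl⟩)
    · simp [sum_mul_tensorString_eq_zero hA hf]
end
end

section
/- Fix N ≥ 2 and let Λ₀ = I^{⊗(N−1)} ⊗ Ỹ. Let G be the subgroup of the orthogonal group O(2^N) generated by all embedded C-NOT gates V_{jk} (1 ≤ j ≠ k ≤ N) together with all local one-rebit SO(2) gates. Then for every Kronecker product string Λ = L₁ ⊗ ⋯ ⊗ L_N with each L_j ∈ {I, X, Z, Ỹ} containing an odd number of factors Ỹ, there exist W ∈ G and a sign ε ∈ {+1, −1} such that W · Λ₀ · Wᵀ = ε·Λ. -/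
open Matrix

noncomputable section

/-- The embedded real C-NOT gate with control `j` and target `k`. -/
def cnot {N : ℕ} (j k : Fin N) : Matrix (Fin N → Fin 2) (Fin N → Fin 2) ℝ :=
  Matrix.of fun r c => if r = Function.update c k (c j + c k) then 1 else 0

/-- A local one-rebit gate `R` acting on rebit `k`. -/
def localGate {N : ℕ} (k : Fin N) (R : Matrix (Fin 2) (Fin 2) ℝ) :
    Matrix (Fin N → Fin 2) (Fin N → Fin 2) ℝ :=
  tensorString fun j => if j = k then R else 1

/-- The group generated by the C-NOT gates and the local one-rebit `SO(2)` gates. -/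
def gateGroup (N : ℕ) : Subgroup (Matrix.orthogonalGroup (Fin N → Fin 2) ℝ) :=
  Subgroup.closure
    {W : Matrix.orthogonalGroup (Fin N → Fin 2) ℝ |
      (∃ j k, j ≠ k ∧ (W : Matrix (Fin N → Fin 2) (Fin N → Fin 2) ℝ) = cnot j k) ∨
      (∃ (k : Fin N) (R : Matrix (Fin 2) (Fin 2) ℝ),
        R ∈ Matrix.orthogonalGroup (Fin 2) ℝ ∧ R.det = 1 ∧
        (W : Matrix (Fin N → Fin 2) (Fin N → Fin 2) ℝ) = localGate k R)}

/-- Two strings are related if some element of the gate group conjugates one to the other,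
up to sign. -/
def GateConj {N : ℕ} (f g : Fin N → Fin 4) : Prop :=
  ∃ W ∈ gateGroup N, ∃ ε : ℝ, (ε = 1 ∨ ε = -1) ∧
    (W : Matrix (Fin N → Fin 2) (Fin N → Fin 2) ℝ) * tensorString (fun j => realPauli (f j)) *
      (W : Matrix (Fin N → Fin 2) (Fin N → Fin 2) ℝ)ᵀ
      = ε • tensorString fun j => realPauli (g j)

theorem GateConj.refl {N : ℕ} (f : Fin N → Fin 4) : GateConj f f :=
  ⟨1, one_mem _, 1, Or.inl rfl, by simp⟩

theorem GateConj.trans {N : ℕ} {f g h : Fin N → Fin 4} (hfg : GateConj f g)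
    (hgh : GateConj g h) : GateConj f h := by
  obtain ⟨V, hV, ε, hε, hVe⟩ := hfg
  obtain ⟨W, hW, δ, hδ, hWe⟩ := hgh
  refine ⟨W * V, mul_mem hW hV, ε * δ, ?_, ?_⟩
  · rcases hε with rfl | rfl <;> rcases hδ with rfl | rfl <;> simp
  · rw [Submonoid.coe_mul, Matrix.transpose_mul]
    calc _ = (W : Matrix (Fin N → Fin 2) (Fin N → Fin 2) ℝ) *
            ((V : Matrix (Fin N → Fin 2) (Fin N → Fin 2) ℝ) *
              tensorString (fun j => realPauli (f j)) *
              (V : Matrix (Fin N → Fin 2) (Fin N → Fin 2) ℝ)ᵀ) *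
            (W : Matrix (Fin N → Fin 2) (Fin N → Fin 2) ℝ)ᵀ := by simp only [Matrix.mul_assoc]
      _ = _ := by rw [hVe, Matrix.mul_smul, Matrix.smul_mul, hWe, smul_smul]

theorem GateConj.symm {N : ℕ} {f g : Fin N → Fin 4} (hfg : GateConj f g) : GateConj g f := by
  obtain ⟨V, hV, ε, hε, hVe⟩ := hfg
  have hVV : (V : Matrix (Fin N → Fin 2) (Fin N → Fin 2) ℝ)ᵀ * V = 1 :=
    (Matrix.mem_orthogonalGroup_iff' _ _).1 V.2
  have hinv : ((V⁻¹ : Matrix.orthogonalGroup (Fin N → Fin 2) ℝ) :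
      Matrix (Fin N → Fin 2) (Fin N → Fin 2) ℝ) =
        (V : Matrix (Fin N → Fin 2) (Fin N → Fin 2) ℝ)ᵀ := rfl
  have hεε : ε * ε = 1 := by rcases hε with rfl | rfl <;> norm_num
  refine ⟨V⁻¹, inv_mem hV, ε, hε, ?_⟩
  rw [hinv, Matrix.transpose_transpose]
  have hg : tensorString (fun j => realPauli (g j)) =
      ε • ((V : Matrix (Fin N → Fin 2) (Fin N → Fin 2) ℝ) *
        tensorString (fun j => realPauli (f j)) *
        (V : Matrix (Fin N → Fin 2) (Fin N → Fin 2) ℝ)ᵀ) := by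
    rw [hVe, smul_smul, hεε, one_smul]
  rw [hg, Matrix.mul_smul, Matrix.smul_mul]
  congr 1
  simp only [Matrix.mul_assoc, hVV, Matrix.mul_one]
  rw [← Matrix.mul_assoc, hVV, Matrix.one_mul]

theorem tensorString_mul {N : ℕ} (A B : Fin N → Matrix (Fin 2) (Fin 2) ℝ) :
    tensorString A * tensorString B = tensorString fun j => A j * B j := by
  ext r c
  simp only [tensorString, Matrix.mul_apply, Matrix.of_apply, ← Finset.prod_mul_distrib]
  rw [Finset.prod_univ_sum, Fintype.piFinset_univ]

theorem tensorString_transpose {N : ℕ} (A : Fin N → Matrix (Fin 2) (Fin 2) ℝ) :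
    (tensorString A)ᵀ = tensorString fun j => (A j)ᵀ := rfl

theorem tensorString_one {N : ℕ} :
    tensorString (fun _ : Fin N => (1 : Matrix (Fin 2) (Fin 2) ℝ)) = 1 := by
  ext r c
  simp only [tensorString, Matrix.of_apply, Matrix.one_apply, Finset.prod_ite_zero,
    Finset.prod_const_one, Finset.mem_univ, true_implies, funext_iff]

theorem tensorString_eq_smul {N : ℕ} {A B : Fin N → Matrix (Fin 2) (Fin 2) ℝ} {ε : ℝ}
    (k : Fin N) (hk : A k = ε • B k) (h : ∀ i, i ≠ k → A i = B i) :
    tensorString A = ε • tensorString B := by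
  ext r c
  simp only [tensorString, Matrix.of_apply, Matrix.smul_apply, smul_eq_mul]
  rw [← Finset.mul_prod_erase _ _ (Finset.mem_univ k),
    ← Finset.mul_prod_erase _ (fun j => B j (r j) (c j)) (Finset.mem_univ k), hk,
    Finset.prod_congr rfl fun i hi => by rw [h i (Finset.ne_of_mem_erase hi)]]
  simp [mul_assoc]

theorem localGate_mem_orthogonalGroup {N : ℕ} (k : Fin N) {R : Matrix (Fin 2) (Fin 2) ℝ}
    (hR : R ∈ Matrix.orthogonalGroup (Fin 2) ℝ) :
    localGate k R ∈ Matrix.orthogonalGroup (Fin N → Fin 2) ℝ := by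
  rw [Matrix.mem_orthogonalGroup_iff] at hR ⊢
  change R * Rᵀ = 1 at hR
  change localGate k R * (localGate k R)ᵀ = 1
  rw [localGate, tensorString_transpose, tensorString_mul, ← tensorString_one]
  congr 1
  ext1 j
  split_ifs
  · exact hR
  · simp

theorem realPauli_zero : realPauli 0 = !![1, 0; 0, 1] := by
  rw [← Matrix.one_fin_two]; rfl

theorem realPauli_one : realPauli 1 = !![0, 1; 1, 0] := rfl

theorem realPauli_two : realPauli 2 = !![1, 0; 0, -1] := rfl

theorem realPauli_three : realPauli 3 = !![0, 1; -1, 0] := rfl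

theorem fin_two_one_add_one : (1 + 1 : Fin 2) = 0 := rfl

/-- The rotation by `π / 4`, which exchanges `X` and `Z` up to sign. -/
def quarterRotation : Matrix (Fin 2) (Fin 2) ℝ :=
  (√2)⁻¹ • !![1, -1; 1, 1]

theorem inv_sqrt_two_mul_self : (√2)⁻¹ * (√2)⁻¹ = (1 / 2 : ℝ) := by
  rw [← mul_inv, Real.mul_self_sqrt (by norm_num), one_div]

theorem quarterRotation_mem : quarterRotation ∈ Matrix.orthogonalGroup (Fin 2) ℝ := by
  rw [Matrix.mem_orthogonalGroup_iff]
  change quarterRotation * quarterRotationᵀ = 1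
  rw [quarterRotation, Matrix.transpose_smul, Matrix.smul_mul, Matrix.mul_smul, smul_smul,
    inv_sqrt_two_mul_self]
  ext i j
  simp only [Matrix.smul_apply, Matrix.mul_apply, Matrix.transpose_apply, Fin.sum_univ_two]
  fin_cases i <;> fin_cases j <;> norm_num

theorem quarterRotation_det : quarterRotation.det = 1 := by
  rw [quarterRotation, Matrix.det_smul, Matrix.det_fin_two_of, Fintype.card_fin, sq,
    inv_sqrt_two_mul_self]
  norm_num

theorem quarterRotation_conj_X :
    quarterRotation * realPauli 1 * quarterRotationᵀ = (-1 : ℝ) • realPauli 2 := by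
  rw [quarterRotation, Matrix.transpose_smul, Matrix.smul_mul, Matrix.smul_mul, Matrix.mul_smul,
    smul_smul, inv_sqrt_two_mul_self]
  ext i j
  simp only [Matrix.smul_apply, Matrix.mul_apply, Matrix.transpose_apply, Fin.sum_univ_two,
    realPauli_one, realPauli_two]
  fin_cases i <;> fin_cases j <;> norm_num

/-- Exchange of `X` and `Z` at a single site. -/
theorem gateConj_X_Z {N : ℕ} {f g : Fin N → Fin 4} (k : Fin N) (hf : f k = 1) (hg : g k = 2)
    (h : ∀ i, i ≠ k → f i = g i) : GateConj f g := by
  refine ⟨⟨localGate k quarterRotation, localGate_mem_orthogonalGroup k quarterRotation_mem⟩,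
    Subgroup.subset_closure (Or.inr ⟨k, _, quarterRotation_mem, quarterRotation_det, rfl⟩),
    -1, Or.inr rfl, ?_⟩
  simp only [localGate, tensorString_transpose, tensorString_mul]
  refine tensorString_eq_smul k ?_ fun i hi => ?_
  · simpa [hf, hg] using quarterRotation_conj_X
  · simp [hi, h i hi]

theorem cnot_involutive {N : ℕ} {j k : Fin N} (hjk : j ≠ k) :
    Function.Involutive fun c : Fin N → Fin 2 => Function.update c k (c j + c k) := by
  intro c
  have h : ∀ a b : Fin 2, a + (a + b) = b := by decide
  simp [Function.update_of_ne hjk, h]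

theorem cnot_conj {N : ℕ} {j k : Fin N} (hjk : j ≠ k)
    (A : Matrix (Fin N → Fin 2) (Fin N → Fin 2) ℝ) :
    cnot j k * A * (cnot j k)ᵀ = A.submatrix (fun c => Function.update c k (c j + c k))
      (fun c => Function.update c k (c j + c k)) := by
  have h : ∀ r c : Fin N → Fin 2,
      cnot j k r c = if Function.update r k (r j + r k) = c then 1 else 0 := fun r c =>
    if_congr (eq_comm.trans ((cnot_involutive hjk).eq_iff.trans eq_comm)) rfl rfl
  ext r c
  simp [Matrix.mul_apply, h]

theorem cnot_mem_orthogonalGroup {N : ℕ} {j k : Fin N} (hjk : j ≠ k) :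
    cnot j k ∈ Matrix.orthogonalGroup (Fin N → Fin 2) ℝ := by
  rw [Matrix.mem_orthogonalGroup_iff]
  have h := cnot_conj hjk 1
  rwa [Matrix.mul_one, Matrix.submatrix_one _ (cnot_involutive hjk).injective] at h

/-- Conjugation by a C-NOT gate only affects the control and target factors. -/
theorem gateConj_cnot {N : ℕ} {f g : Fin N → Fin 4} {j k : Fin N} (hjk : j ≠ k) {ε : ℝ}
    (hε : ε = 1 ∨ ε = -1)
    (hloc : ∀ r s c d : Fin 2, realPauli (f j) r c * realPauli (f k) (r + s) (c + d) =
      ε * (realPauli (g j) r c * realPauli (g k) s d))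
    (h : ∀ i, i ≠ j → i ≠ k → f i = g i) : GateConj f g := by
  refine ⟨⟨cnot j k, cnot_mem_orthogonalGroup hjk⟩,
    Subgroup.subset_closure (Or.inl ⟨j, k, hjk, rfl⟩), ε, hε, ?_⟩
  change cnot j k * _ * (cnot j k)ᵀ = _
  rw [cnot_conj hjk]
  ext r c
  simp only [tensorString, Matrix.submatrix_apply, Matrix.of_apply, Matrix.smul_apply,
    smul_eq_mul]
  have hj : j ∈ Finset.univ.erase k := by simp [hjk]
  rw [← Finset.mul_prod_erase _ _ (Finset.mem_univ k), ← Finset.mul_prod_erase _ _ hj,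
    ← Finset.mul_prod_erase _ (fun i => realPauli (g i) (r i) (c i)) (Finset.mem_univ k),
    ← Finset.mul_prod_erase _ (fun i => realPauli (g i) (r i) (c i)) hj]
  have hprod : ∏ i ∈ (Finset.univ.erase k).erase j,
      realPauli (f i) (Function.update r k (r j + r k) i) (Function.update c k (c j + c k) i) =
      ∏ i ∈ (Finset.univ.erase k).erase j, realPauli (g i) (r i) (c i) := by
    refine Finset.prod_congr rfl fun i hi => ?_
    simp only [Finset.mem_erase, Finset.mem_univ, and_true] at hi
    rw [Function.update_of_ne hi.2, Function.update_of_ne hi.2, h i hi.1 hi.2]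
  rw [hprod, Function.update_self, Function.update_self, Function.update_of_ne hjk,
    Function.update_of_ne hjk]
  linear_combination (∏ i ∈ (Finset.univ.erase k).erase j, realPauli (g i) (r i) (c i)) *
    hloc (r j) (r k) (c j) (c k)

/-- A factor `X` or `Z` next to a factor `Ỹ` can be erased. -/
theorem gateConj_erase {N : ℕ} {f : Fin N → Fin 4} {p q : Fin N} (hqp : q ≠ p) (hp : f p = 3)
    (hq : f q = 1 ∨ f q = 2) : GateConj f (Function.update f q 0) := by
  have key : GateConj (Function.update f q 2) (Function.update f q 0) := by
    refine gateConj_cnot hqp (Or.inl rfl) ?_ fun i hi _ => by simp [hi]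
    simp only [Function.update_self, Function.update_of_ne hqp.symm, hp, Fin.forall_fin_two]
    norm_num [realPauli_zero, realPauli_one, realPauli_two, realPauli_three, fin_two_one_add_one]
  rcases hq with hq | hq
  · exact (gateConj_X_Z q hq (by simp) fun i hi => by simp [hi]).trans key
  · rwa [← hq, Function.update_eq_self] at key

/-- A pair of factors `Ỹ ⊗ Ỹ` can be replaced by `X ⊗ I`. -/
theorem gateConj_YY {N : ℕ} {f : Fin N → Fin 4} {p q : Fin N} (hpq : p ≠ q) (hp : f p = 3)
    (hq : f q = 3) : GateConj f (Function.update (Function.update f p 1) q 0) := by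
  have h₁ : GateConj f (Function.update (Function.update f p 1) q 2) := by
    refine gateConj_cnot hpq (Or.inl rfl) ?_ fun i hi hi' => by simp [hi, hi']
    simp only [Function.update_self, Function.update_of_ne hpq, hp, hq, Fin.forall_fin_two]
    norm_num [realPauli_zero, realPauli_one, realPauli_two, realPauli_three, fin_two_one_add_one]
  have h₂ : GateConj (Function.update (Function.update f p 1) q 1)
      (Function.update (Function.update f p 1) q 2) :=
    gateConj_X_Z q (by simp) (by simp) fun i hi => by simp [hi]
  have h₃ : GateConj (Function.update (Function.update f p 1) q 1)
      (Function.update (Function.update f p 1) q 0) := by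
    refine gateConj_cnot hpq (Or.inl rfl) ?_ fun i hi hi' => by simp [hi, hi']
    simp only [Function.update_self, Function.update_of_ne hpq, Fin.forall_fin_two]
    norm_num [realPauli_zero, realPauli_one, realPauli_two, realPauli_three, fin_two_one_add_one]
  exact (h₁.trans h₂.symm).trans h₃

/-- A single factor `Ỹ` can be moved to any other site. -/
theorem gateConj_single {N : ℕ} (p q : Fin N) :
    GateConj (Function.update (fun _ => 0) p 3) (Function.update (fun _ => 0) q 3) := by
  rcases eq_or_ne p q with rfl | hpq
  · exact .refl _
  have hp : GateConj (Function.update (Function.update (fun _ => 0) p 3) q 1)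
      (Function.update (fun _ => 0) p 3) := by
    have h := gateConj_erase (f := Function.update (Function.update (fun _ => 0) p 3) q 1)
      hpq.symm (by simp [hpq]) (Or.inl (by simp))
    rw [Function.update_idem] at h
    rwa [Function.update_eq_self_iff (a := q) (b := 0).2 (by simp [hpq.symm])] at h
  have hq : GateConj (Function.update (Function.update (fun _ => 0) q 3) p 2)
      (Function.update (fun _ => 0) q 3) := by
    have h := gateConj_erase (f := Function.update (Function.update (fun _ => 0) q 3) p 2)
      hpq (by simp [hpq.symm]) (Or.inr (by simp))
    rw [Function.update_idem] at h
    rwa [Function.update_eq_self_iff (a := p) (b := 0).2 (by simp [hpq])] at h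
  refine (hp.symm.trans ?_).trans hq
  refine gateConj_cnot hpq.symm (Or.inl rfl) ?_ fun i hi hi' => by simp [hi, hi']
  simp only [Function.update_self, Function.update_of_ne hpq, Function.update_of_ne hpq.symm,
    Fin.forall_fin_two]
  norm_num [realPauli_zero, realPauli_one, realPauli_two, realPauli_three, fin_two_one_add_one]

/-- Every string with an odd number of factors `Ỹ` reduces to a single `Ỹ` at a given site. -/
theorem gateConj_single_of_odd {N : ℕ} (l : Fin N) (f : Fin N → Fin 4)
    (hodd : Odd (Finset.univ.filter fun j => f j = 3).card) :
    GateConj f (Function.update (fun _ => 0) l 3) := by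
  induction hn : (Finset.univ.filter fun j => f j ≠ 0).card using Nat.strong_induction_on
    generalizing f with
  | _ n ih =>
  obtain ⟨p, hp⟩ := Finset.card_pos.1 hodd.pos
  replace hp : f p = 3 := by simpa using hp
  by_cases hq : ∃ q, q ≠ p ∧ f q ≠ 0
  · obtain ⟨q, hqp, hq⟩ := hq
    by_cases hq3 : f q = 3
    · refine (gateConj_YY hqp.symm hp hq3).trans (ih _ ?_ _ ?_ rfl)
      · rw [← hn]
        refine Finset.card_lt_card (Finset.ssubset_iff_of_subset ?_ |>.2 ⟨q, by simp [hq], by simp⟩)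
        intro i
        by_cases hip : i = p <;> by_cases hiq : i = q <;> simp_all [Function.update_apply]
      · have hset : (Finset.univ.filter fun j => f j = 3) = insert p (insert q
            (Finset.univ.filter fun j =>
              Function.update (Function.update f p 1) q 0 j = 3)) := by
          ext i
          by_cases hip : i = p <;> by_cases hiq : i = q <;> simp_all [Function.update_apply]
        rw [hset, Finset.card_insert_of_notMem (by simp [hqp.symm]),
          Finset.card_insert_of_notMem (by simp)] at hodd
        simpa [Nat.odd_add_one] using hodd
    · have hq12 : f q = 1 ∨ f q = 2 := by
        generalize f q = a at hq hq3
        revert a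
        decide
      refine (gateConj_erase hqp hp hq12).trans (ih _ ?_ _ ?_ rfl)
      · rw [← hn]
        refine Finset.card_lt_card (Finset.ssubset_iff_of_subset ?_ |>.2 ⟨q, by simp [hq], by simp⟩)
        intro i
        by_cases hiq : i = q <;> simp_all [Function.update_apply]
      · convert hodd using 3 with i
        by_cases hiq : i = q <;> simp_all
  · push Not at hq
    have hf : f = Function.update (fun _ => 0) p 3 := by
      ext1 i
      by_cases hip : i = p
      · simp [hip, hp]
      · simp [hip, hq i hip]
    rw [hf]
    exact gateConj_single p l

/-- Starting from `Λ₀ = I^{⊗(N-1)} ⊗ Ỹ`, conjugation by elements of the group generated by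
C-NOTs and local one-rebit `SO(2)` gates produces, up to a sign `ε ∈ {+1, −1}`, every string
`L₁ ⊗ ⋯ ⊗ L_N`, `L_j ∈ {I, X, Z, Ỹ}`, with an odd number of `Ỹ` factors. -/
theorem generate_odd_Ytilde_strings_from_IY (N : ℕ) (hN : 2 ≤ N) :
    ∀ f : Fin N → Fin 4, Odd (Finset.univ.filter fun j => f j = 3).card →
      ∃ W ∈ Subgroup.closure
          {W : Matrix.orthogonalGroup (Fin N → Fin 2) ℝ |
            (∃ j k, j ≠ k ∧ (W : Matrix (Fin N → Fin 2) (Fin N → Fin 2) ℝ) = cnot j k) ∨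
            (∃ (k : Fin N) (R : Matrix (Fin 2) (Fin 2) ℝ),
              R ∈ Matrix.orthogonalGroup (Fin 2) ℝ ∧ R.det = 1 ∧
              (W : Matrix (Fin N → Fin 2) (Fin N → Fin 2) ℝ) = localGate k R)},
        ∃ ε : ℝ, (ε = 1 ∨ ε = -1) ∧
          (W : Matrix (Fin N → Fin 2) (Fin N → Fin 2) ℝ) *
              tensorString (fun j => realPauli (if (j : ℕ) = N - 1 then 3 else 0)) *
              (W : Matrix (Fin N → Fin 2) (Fin N → Fin 2) ℝ)ᵀ
            = ε • tensorString fun j => realPauli (f j) := by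
  intro f hf
  have h := (gateConj_single_of_odd ⟨N - 1, by omega⟩ f hf).symm
  have h0 : Function.update (fun _ => 0) ⟨N - 1, by omega⟩ 3 =
      fun j : Fin N => if (j : ℕ) = N - 1 then (3 : Fin 4) else 0 := by
    ext1 j
    simp [Function.update_apply, Fin.ext_iff]
  rwa [h0] at h
end
end

section
/- (Universality of C-NOT with local gates for real quantum theory) Fix N ≥ 2 and let G be the subgroup of the orthogonal group O(2^N) generated by all embedded C-NOT gates V_{jk} (1 ≤ j ≠ k ≤ N) together with all local one-rebit orthogonal gates. Then G contains every element of the special orthogonal group SO(2^N). -/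
open Matrix

noncomputable section

/-- The generating set: all embedded C-NOTs and all local one-rebit orthogonal gates. -/
def gateSet (N : ℕ) : Set (Matrix.orthogonalGroup (Fin N → Fin 2) ℝ) :=
  {W | (∃ j k, j ≠ k ∧ (W : Matrix (Fin N → Fin 2) (Fin N → Fin 2) ℝ) = cnot j k) ∨
    (∃ (k : Fin N) (R : Matrix (Fin 2) (Fin 2) ℝ), R ∈ Matrix.orthogonalGroup (Fin 2) ℝ ∧
      (W : Matrix (Fin N → Fin 2) (Fin N → Fin 2) ℝ) = localGate k R)}

section Givens

variable {n : Type*} [DecidableEq n]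

/-- The rotation by the angle `θ` in the coordinate plane spanned by `e i` and `e j`. -/
def givens (i j : n) (θ : ℝ) : Matrix n n ℝ :=
  Matrix.of fun r c =>
    if r = i then Real.cos θ * (1 : Matrix n n ℝ) i c - Real.sin θ * (1 : Matrix n n ℝ) j c
    else if r = j then Real.sin θ * (1 : Matrix n n ℝ) i c + Real.cos θ * (1 : Matrix n n ℝ) j c
    else (1 : Matrix n n ℝ) r c

theorem givens_zero (i j : n) : givens i j 0 = 1 := by
  ext r c
  simp only [givens, Matrix.of_apply, Real.cos_zero, Real.sin_zero]
  split_ifs with hi hj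
  · rw [hi, one_mul, zero_mul, sub_zero]
  · rw [hj, zero_mul, one_mul, zero_add]
  · rfl

theorem transpose_givens {i j : n} (hij : i ≠ j) (θ : ℝ) :
    (givens i j θ)ᵀ = givens i j (-θ) := by
  ext r c
  simp only [givens, Matrix.of_apply, Matrix.transpose_apply, Real.cos_neg, Real.sin_neg,
    Matrix.one_apply]
  grind

theorem givens_swap {i j : n} (hij : i ≠ j) (θ : ℝ) : givens j i θ = givens i j (-θ) := by
  ext r c
  simp only [givens, Matrix.of_apply, Real.cos_neg, Real.sin_neg, Matrix.one_apply]
  grind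

variable [Fintype n]

theorem givens_mul_apply (i j : n) (θ : ℝ) (M : Matrix n n ℝ) (r c : n) :
    (givens i j θ * M) r c =
      if r = i then Real.cos θ * M i c - Real.sin θ * M j c
      else if r = j then Real.sin θ * M i c + Real.cos θ * M j c
      else M r c := by
  simp only [Matrix.mul_apply, givens, Matrix.of_apply]
  split_ifs <;>
    simp [Matrix.one_apply, sub_mul, add_mul, Finset.sum_add_distrib, Finset.sum_sub_distrib]

theorem givens_mul_givens {i j : n} (hij : i ≠ j) (θ φ : ℝ) :
    givens i j θ * givens i j φ = givens i j (θ + φ) := by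
  ext r c
  rw [givens_mul_apply]
  simp only [givens, Matrix.of_apply, Real.cos_add, Real.sin_add, hij.symm, if_true, if_false]
  split_ifs <;> ring

theorem givens_neg_mul {i j : n} (hij : i ≠ j) (θ : ℝ) (M : Matrix n n ℝ) :
    givens i j (-θ) * (givens i j θ * M) = M := by
  rw [← Matrix.mul_assoc, givens_mul_givens hij, neg_add_cancel, givens_zero, Matrix.one_mul]

theorem givens_mem_orthogonalGroup {i j : n} (hij : i ≠ j) (θ : ℝ) :
    givens i j θ ∈ Matrix.orthogonalGroup n ℝ := by
  rw [Matrix.mem_orthogonalGroup_iff, transpose_givens hij, givens_mul_givens hij,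
    add_neg_cancel, givens_zero]

theorem det_givens {i j : n} (hij : i ≠ j) (θ : ℝ) : (givens i j θ).det = 1 := by
  have h := congrArg Matrix.det (givens_mul_givens hij (θ / 2) (-(θ / 2)))
  rw [add_neg_cancel, givens_zero, Matrix.det_mul, Matrix.det_one, ← transpose_givens hij,
    Matrix.det_transpose] at h
  rw [← add_halves θ, ← givens_mul_givens hij, Matrix.det_mul, h]

/-- Conjugating by a quarter turn in the plane `(j, k)` moves the plane `(i, j)` to `(i, k)`. -/
theorem givens_conj {i j k : n} (hij : i ≠ j) (hjk : j ≠ k) (hik : i ≠ k) (θ : ℝ) :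
    givens j k (Real.pi / 2) * (givens i j θ * givens j k (-(Real.pi / 2))) = givens i k θ := by
  ext r c
  simp only [givens_mul_apply]
  simp only [givens, Matrix.of_apply, Real.cos_neg, Real.sin_neg, Real.cos_pi_div_two,
    Real.sin_pi_div_two]
  grind

theorem exists_rotation_eq_zero (a b : ℝ) :
    ∃ θ : ℝ, 0 ≤ Real.cos θ * a - Real.sin θ * b ∧ Real.sin θ * a + Real.cos θ * b = 0 := by
  obtain ⟨r, φ, hr, rfl, rfl⟩ : ∃ r φ : ℝ, 0 ≤ r ∧ a = r * Real.cos φ ∧ b = r * Real.sin φ :=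
    ⟨‖(⟨a, b⟩ : ℂ)‖, Complex.arg ⟨a, b⟩, norm_nonneg _,
      (Complex.norm_mul_cos_arg ⟨a, b⟩).symm, (Complex.norm_mul_sin_arg ⟨a, b⟩).symm⟩
  refine ⟨-φ, ?_, ?_⟩
  · rw [Real.cos_neg, Real.sin_neg]
    nlinarith [Real.sin_sq_add_cos_sq φ]
  · rw [Real.cos_neg, Real.sin_neg]
    ring

/-- Rotations in the planes `(i, j)` with `j ∈ T` clear the entries of column `i` in the rows
of `T`. -/
theorem exists_clear_column (P : Submonoid (Matrix n n ℝ))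
    (hP : ∀ i j : n, i ≠ j → ∀ θ, givens i j θ ∈ P) {A : Matrix n n ℝ}
    (hA : A ∈ Matrix.orthogonalGroup n ℝ) (hdet : A.det = 1) (i : n) (T : Finset n)
    (hi : i ∉ T) :
    ∃ B ∈ Matrix.orthogonalGroup n ℝ, B.det = 1 ∧ (B ∈ P → A ∈ P) ∧
      (∀ r, r ≠ i → r ∉ T → B r = A r) ∧ (∀ r ∈ T, B r i = 0) ∧ (T.Nonempty → 0 ≤ B i i) := by
  induction T using Finset.induction_on with
  | empty => exact ⟨A, hA, hdet, id, by simp, by simp, by simp⟩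
  | insert j T hj ih =>
    obtain ⟨hij, hiT⟩ : i ≠ j ∧ i ∉ T := by simpa using hi
    obtain ⟨B, hB, hBdet, hBA, hrow, hcol, -⟩ := ih hiT
    obtain ⟨θ, hpos, hzero⟩ := exists_rotation_eq_zero (B i i) (B j i)
    refine ⟨givens i j θ * B, mul_mem (givens_mem_orthogonalGroup hij θ) hB, ?_, fun h => hBA ?_,
      fun r hri hrT => ?_, fun r hr => ?_, fun _ => ?_⟩
    · rw [Matrix.det_mul, det_givens hij, hBdet, one_mul]
    · rw [← givens_neg_mul hij θ B]
      exact P.mul_mem (hP i j hij _) h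
    · obtain ⟨hrj, hrT⟩ : r ≠ j ∧ r ∉ T := by simpa using hrT
      ext c
      rw [givens_mul_apply, if_neg hri, if_neg hrj, hrow r hri hrT]
    · rw [givens_mul_apply]
      grind
    · rwa [givens_mul_apply, if_pos rfl]

theorem row_dotProduct_of_mem_orthogonalGroup {A : Matrix n n ℝ}
    (hA : A ∈ Matrix.orthogonalGroup n ℝ) (r s : n) :
    ∑ c, A r c * A s c = (1 : Matrix n n ℝ) r s := by
  rw [Matrix.mem_orthogonalGroup_iff] at hA
  simpa [Matrix.mul_apply] using congrFun (congrFun hA r) s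

theorem col_dotProduct_of_mem_orthogonalGroup {A : Matrix n n ℝ}
    (hA : A ∈ Matrix.orthogonalGroup n ℝ) (r s : n) :
    ∑ c, A c r * A c s = (1 : Matrix n n ℝ) r s := by
  rw [Matrix.mem_orthogonalGroup_iff'] at hA
  simpa [Matrix.mul_apply] using congrFun (congrFun hA r) s

theorem row_eq_one_of_diag_eq_one {A : Matrix n n ℝ} (hA : A ∈ Matrix.orthogonalGroup n ℝ)
    {i : n} (h : A i i = 1) : A i = (1 : Matrix n n ℝ) i := by
  have hsum := row_dotProduct_of_mem_orthogonalGroup hA i i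
  rw [← Finset.add_sum_erase _ _ (Finset.mem_univ i), h, Matrix.one_apply_eq] at hsum
  have hz : ∑ c ∈ Finset.univ.erase i, A i c * A i c = 0 := by linarith
  rw [Finset.sum_eq_zero_iff_of_nonneg fun c _ => mul_self_nonneg _] at hz
  ext c
  by_cases hc : c = i
  · rw [hc, h, Matrix.one_apply_eq]
  · rw [Matrix.one_apply_ne' hc]
    exact mul_self_eq_zero.mp (hz c (by simp [hc]))

/-- An orthogonal matrix of determinant one which fixes all but one coordinate row is trivial on
that row as well. -/
theorem diag_eq_one_of_rows {A : Matrix n n ℝ} (hA : A ∈ Matrix.orthogonalGroup n ℝ)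
    (hdet : A.det = 1) {i : n} (h : ∀ r, r ≠ i → A r = (1 : Matrix n n ℝ) r) : A i i = 1 := by
  have hdiag : A = Matrix.diagonal fun r => A r r := by
    ext r c
    by_cases hrc : r = c
    · rw [hrc, Matrix.diagonal_apply_eq]
    rw [Matrix.diagonal_apply_ne _ hrc]
    by_cases hr : r = i
    · have hc : c ≠ i := fun hc => hrc (hr.trans hc.symm)
      have := row_dotProduct_of_mem_orthogonalGroup hA r c
      rw [h c hc] at this
      simpa [Matrix.one_apply, hrc] using this
    · rw [h r hr, Matrix.one_apply_ne hrc]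
  rw [hdiag, Matrix.det_diagonal, Finset.prod_eq_single i] at hdet
  · exact hdet
  · intro r _ hr
    rw [h r hr, Matrix.one_apply_eq]
  · simp

/-- Rotations in coordinate planes generate the special orthogonal group. -/
theorem mem_of_givens_mem (P : Submonoid (Matrix n n ℝ))
    (hP : ∀ i j : n, i ≠ j → ∀ θ, givens i j θ ∈ P) {A : Matrix n n ℝ}
    (hA : A ∈ Matrix.orthogonalGroup n ℝ) (hdet : A.det = 1) : A ∈ P := by
  suffices H : ∀ (S : Finset n) (A : Matrix n n ℝ), A ∈ Matrix.orthogonalGroup n ℝ → A.det = 1 →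
      (∀ r ∉ S, A r = (1 : Matrix n n ℝ) r) → A ∈ P from
    H Finset.univ A hA hdet (by simp)
  intro S
  induction S using Finset.induction_on with
  | empty =>
    intro A _ _ hrow
    have : A = 1 := funext fun r => hrow r (by simp)
    exact this ▸ P.one_mem
  | insert i S hi ih =>
    intro A hA hdet hrow
    obtain ⟨B, hB, hBdet, hBA, hBrow, hBcol, hBpos⟩ := exists_clear_column P hP hA hdet i S hi
    have hrowB : ∀ r, r ≠ i → r ∉ S → B r = (1 : Matrix n n ℝ) r := fun r hr hrS => by
      rw [hBrow r hr hrS, hrow r (by simp [hr, hrS])]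
    have hii : B i i = 1 := by
      rcases S.eq_empty_or_nonempty with rfl | hS
      · exact diag_eq_one_of_rows hB hBdet fun r hr => hrowB r hr (by simp)
      · have hsum := col_dotProduct_of_mem_orthogonalGroup hB i i
        rw [Finset.sum_eq_single i, Matrix.one_apply_eq] at hsum
        · nlinarith [hBpos hS]
        · intro r _ hr
          by_cases hrS : r ∈ S
          · rw [hBcol r hrS, zero_mul]
          · rw [hrowB r hr hrS, Matrix.one_apply_ne hr, zero_mul]
        · simp
    refine hBA (ih B hB hBdet fun r hrS => ?_)
    by_cases hr : r = i
    · exact hr ▸ row_eq_one_of_diag_eq_one hB hii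
    · exact hrowB r hr hrS

/-- The indices `i` and `j` are equal or `P` contains all rotations in their plane. -/
def RotationConnected (P : Submonoid (Matrix n n ℝ)) (i j : n) : Prop :=
  i ≠ j → ∀ θ, givens i j θ ∈ P

theorem RotationConnected.symm {P : Submonoid (Matrix n n ℝ)} {i j : n}
    (h : RotationConnected P i j) : RotationConnected P j i := fun hji θ => by
  rw [givens_swap hji.symm]
  exact h hji.symm _

theorem RotationConnected.trans {P : Submonoid (Matrix n n ℝ)} {i j k : n}
    (hij : RotationConnected P i j) (hjk : RotationConnected P j k) :
    RotationConnected P i k := fun hik θ => by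
  by_cases h₁ : i = j
  · subst h₁
    exact hjk hik θ
  by_cases h₂ : j = k
  · subst h₂
    exact hij hik θ
  rw [← givens_conj h₁ h₂ hik]
  exact P.mul_mem (hjk h₂ _) (P.mul_mem (hij h₁ _) (hjk h₂ _))

end Givens

section Gates

variable {N : ℕ}

/-- The gate acting on rebit `k` by the matrix `F r`, where `r` is the state of the other
rebits; the `k`-th bit of the argument of `F` is set to `0`. -/
def multiplexed (k : Fin N) (F : (Fin N → Fin 2) → Matrix (Fin 2) (Fin 2) ℝ) :
    Matrix (Fin N → Fin 2) (Fin N → Fin 2) ℝ :=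
  Matrix.of fun r c =>
    ∑ x, if c = Function.update r k x then F (Function.update r k 0) (r k) x else 0

theorem multiplexed_mul_apply (k : Fin N) (F : (Fin N → Fin 2) → Matrix (Fin 2) (Fin 2) ℝ)
    (M : Matrix (Fin N → Fin 2) (Fin N → Fin 2) ℝ) (r c : Fin N → Fin 2) :
    (multiplexed k F * M) r c =
      ∑ x, F (Function.update r k 0) (r k) x * M (Function.update r k x) c := by
  simp only [Matrix.mul_apply, multiplexed, Matrix.of_apply, Finset.sum_mul]
  rw [Finset.sum_comm]
  simp [ite_mul]

theorem multiplexed_mul (k : Fin N) (F F' : (Fin N → Fin 2) → Matrix (Fin 2) (Fin 2) ℝ) :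
    multiplexed k F * multiplexed k F' = multiplexed k (F * F') := by
  ext r c
  rw [multiplexed_mul_apply]
  simp only [multiplexed, Matrix.of_apply, Function.update_idem, Function.update_self,
    Pi.mul_apply, Matrix.mul_apply, Finset.mul_sum]
  rw [Finset.sum_comm]
  refine Finset.sum_congr rfl fun x _ => ?_
  split_ifs <;> simp

theorem multiplexed_apply (k : Fin N) (F : (Fin N → Fin 2) → Matrix (Fin 2) (Fin 2) ℝ)
    (r c : Fin N → Fin 2) :
    multiplexed k F r c =
      if ∀ j, j ≠ k → c j = r j then F (Function.update r k 0) (r k) (c k) else 0 := by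
  simp only [multiplexed, Matrix.of_apply, Function.eq_update_iff, ite_and]
  simp

theorem multiplexed_one (k : Fin N) : multiplexed k 1 = 1 := by
  ext r c
  rw [multiplexed_apply, Pi.one_apply, Matrix.one_apply, Matrix.one_apply]
  have : r = c ↔ (∀ j, j ≠ k → c j = r j) ∧ r k = c k := by
    refine ⟨fun h => by simp [h], fun h => funext fun j => ?_⟩
    by_cases hj : j = k
    · rw [hj, h.2]
    · exact (h.1 j hj).symm
  simp only [this, ite_and]

theorem transpose_multiplexed (k : Fin N) (F : (Fin N → Fin 2) → Matrix (Fin 2) (Fin 2) ℝ) :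
    (multiplexed k F)ᵀ = multiplexed k fun r => (F r)ᵀ := by
  ext r c
  simp only [Matrix.transpose_apply, multiplexed_apply]
  by_cases h : ∀ j, j ≠ k → c j = r j
  · have h0 : Function.update c k 0 = Function.update r k 0 := by
      ext j
      by_cases hj : j = k
      · simp [hj]
      · simp [hj, h j hj]
    rw [if_pos h, if_pos fun j hj => (h j hj).symm, h0]
  · rw [if_neg h, if_neg fun h' => h fun j hj => (h' j hj).symm]

theorem multiplexed_mem_orthogonalGroup (k : Fin N)
    {F : (Fin N → Fin 2) → Matrix (Fin 2) (Fin 2) ℝ}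
    (hF : ∀ r, F r ∈ Matrix.orthogonalGroup (Fin 2) ℝ) :
    multiplexed k F ∈ Matrix.orthogonalGroup (Fin N → Fin 2) ℝ := by
  rw [Matrix.mem_orthogonalGroup_iff, transpose_multiplexed, multiplexed_mul,
    ← multiplexed_one k]
  congr 1
  ext1 r
  simpa [Matrix.mem_orthogonalGroup_iff] using hF r

/-- The identity for `a = 0` and the bit flip for `a = 1`. -/
def flipMatrix (a : Fin 2) : Matrix (Fin 2) (Fin 2) ℝ :=
  Matrix.of fun x y => if y = a + x then 1 else 0

theorem flipMatrix_zero : flipMatrix 0 = 1 := by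
  ext x y
  fin_cases x <;> fin_cases y <;> simp [flipMatrix]

theorem flipMatrix_one : flipMatrix 1 = !![0, 1; 1, 0] := by
  ext x y
  fin_cases x <;> fin_cases y <;> simp [flipMatrix]

theorem flipMatrix_mem_orthogonalGroup (a : Fin 2) :
    flipMatrix a ∈ Matrix.orthogonalGroup (Fin 2) ℝ := by
  fin_cases a
  · exact flipMatrix_zero ▸ one_mem _
  · change flipMatrix 1 ∈ _
    rw [flipMatrix_one, Matrix.mem_orthogonalGroup_iff]
    ext x y
    fin_cases x <;> fin_cases y <;> simp [Matrix.mul_apply]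

theorem cnot_eq_multiplexed {j k : Fin N} (hjk : j ≠ k) :
    cnot j k = multiplexed k fun r => flipMatrix (r j) := by
  ext r c
  rw [multiplexed_apply]
  simp only [cnot, Matrix.of_apply, flipMatrix, Function.update_of_ne hjk,
    Function.eq_update_iff]
  rw [← ite_and]
  refine if_congr ?_ rfl rfl
  have key : ∀ a x y : Fin 2, x = a + y ↔ y = a + x := by decide
  constructor
  · rintro ⟨h, h'⟩
    exact ⟨fun i hi => (h' i hi).symm, by rw [← h' j hjk] at h; exact (key _ _ _).mp h⟩
  · rintro ⟨h', h⟩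
    exact ⟨by rw [h' j hjk]; exact (key _ _ _).mp h, fun i hi => (h' i hi).symm⟩

theorem localGate_eq_multiplexed (k : Fin N) (R : Matrix (Fin 2) (Fin 2) ℝ) :
    localGate k R = multiplexed k fun _ => R := by
  ext r c
  rw [multiplexed_apply]
  simp only [localGate, tensorString, Matrix.of_apply]
  rw [← Finset.mul_prod_erase _ _ (Finset.mem_univ k), if_pos rfl]
  split_ifs with h
  · rw [Finset.prod_eq_one, mul_one]
    intro j hj
    have hj := Finset.ne_of_mem_erase hj
    rw [if_neg hj, h j hj, Matrix.one_apply_eq]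
  · push Not at h
    obtain ⟨j, hj, hne⟩ := h
    rw [Finset.prod_eq_zero (i := j) (by simp [hj]), mul_zero]
    rw [if_neg hj, Matrix.one_apply_ne hne.symm]

/-- The rotation of the plane by the angle `θ`. -/
def planeRotation (θ : ℝ) : Matrix (Fin 2) (Fin 2) ℝ :=
  !![Real.cos θ, -Real.sin θ; Real.sin θ, Real.cos θ]

theorem planeRotation_mul (θ φ : ℝ) :
    planeRotation θ * planeRotation φ = planeRotation (θ + φ) := by
  simp only [planeRotation, Matrix.mul_fin_two, Real.cos_add, Real.sin_add]
  congr! 3 <;> ring_nf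

theorem planeRotation_zero : planeRotation 0 = 1 := by
  simp [planeRotation, Matrix.one_fin_two]

theorem flipMatrix_one_conj (θ : ℝ) :
    flipMatrix 1 * planeRotation θ * flipMatrix 1 = planeRotation (-θ) := by
  simp [flipMatrix_one, planeRotation]

theorem planeRotation_mem_orthogonalGroup (θ : ℝ) :
    planeRotation θ ∈ Matrix.orthogonalGroup (Fin 2) ℝ := by
  have : (planeRotation θ)ᵀ = planeRotation (-θ) := by
    ext x y
    fin_cases x <;> fin_cases y <;> simp [planeRotation]
  rw [Matrix.mem_orthogonalGroup_iff, this, planeRotation_mul, add_neg_cancel, planeRotation_zero]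

/-- The matrices of the circuits built from C-NOTs and local gates. -/
def circuits (N : ℕ) : Submonoid (Matrix (Fin N → Fin 2) (Fin N → Fin 2) ℝ) :=
  (Subgroup.closure (gateSet N)).toSubmonoid.map
    (Matrix.orthogonalGroup (Fin N → Fin 2) ℝ).subtype

theorem multiplexed_flip_mem_circuits {j k : Fin N} (hjk : j ≠ k) :
    (multiplexed k fun r => flipMatrix (r j)) ∈ circuits N :=
  ⟨⟨_, multiplexed_mem_orthogonalGroup k fun r => flipMatrix_mem_orthogonalGroup (r j)⟩,
    Subgroup.subset_closure (Or.inl ⟨j, k, hjk, (cnot_eq_multiplexed hjk).symm⟩), rfl⟩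

theorem multiplexed_rotation_mem_circuits (k : Fin N) (θ : ℝ) :
    (multiplexed k fun _ => planeRotation θ) ∈ circuits N :=
  ⟨⟨_, multiplexed_mem_orthogonalGroup k fun _ => planeRotation_mem_orthogonalGroup θ⟩,
    Subgroup.subset_closure (Or.inr ⟨k, planeRotation θ, planeRotation_mem_orthogonalGroup θ,
      (localGate_eq_multiplexed k _).symm⟩), rfl⟩

/-- Rotations of rebit `k` controlled by any set of other rebits are circuits: a further control
`j` is added by multiplying with a conjugate by the C-NOT gate from `j` to `k`. -/
theorem controlled_rotation_mem_circuits (k : Fin N) (b : Fin N → Fin 2) (T : Finset (Fin N))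
    (hk : k ∉ T) (θ : ℝ) :
    (multiplexed k fun r => if ∀ j ∈ T, r j = b j then planeRotation θ else 1) ∈ circuits N := by
  induction T using Finset.induction_on generalizing θ with
  | empty => simpa using multiplexed_rotation_mem_circuits k θ
  | insert j T hj ih =>
    obtain ⟨hkj, hkT⟩ : k ≠ j ∧ k ∉ T := by simpa using hk
    have hX := multiplexed_flip_mem_circuits (N := N) hkj.symm
    have hXX : flipMatrix 1 * flipMatrix 1 = 1 := by
      simp [flipMatrix_one, Matrix.one_fin_two]
    have hflip : ∀ a b : Fin 2, planeRotation (θ / 2) *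
        (flipMatrix a * planeRotation (if b = 0 then θ / 2 else -(θ / 2)) * flipMatrix a) =
        if a = b then planeRotation θ else 1 := by
      intro a b
      fin_cases a <;> fin_cases b <;>
        simp [flipMatrix_zero, flipMatrix_one_conj, planeRotation_mul, planeRotation_zero]
    have hmem := mul_mem (ih hkT (θ / 2))
      (mul_mem (mul_mem hX (ih hkT (if b j = 0 then θ / 2 else -(θ / 2)))) hX)
    rw [multiplexed_mul, multiplexed_mul, multiplexed_mul] at hmem
    convert hmem using 2
    ext1 r
    simp only [Pi.mul_apply, Finset.forall_mem_insert]
    by_cases hT : ∀ i ∈ T, r i = b i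
    · simp only [if_pos hT, hflip]
      exact if_congr (and_iff_left hT) rfl rfl
    · rw [if_neg fun h => hT h.2, if_neg hT, if_neg hT, one_mul, mul_one]
      rcases Fin.exists_fin_two.mp ⟨r j, rfl⟩ with h | h
      · rw [h, flipMatrix_zero, mul_one]
      · rw [h, hXX]

theorem multiplexed_eq_givens (k : Fin N) (b : Fin N → Fin 2) (θ : ℝ) :
    (multiplexed k fun r => if ∀ j ∈ Finset.univ.erase k, r j = b j then planeRotation θ else 1) =
      givens (Function.update b k 0) (Function.update b k 1) θ := by
  have hone : ∀ x c, (1 : Matrix (Fin N → Fin 2) (Fin N → Fin 2) ℝ) (Function.update b k x) c =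
      if ∀ j, j ≠ k → c j = b j then (1 : Matrix (Fin 2) (Fin 2) ℝ) x (c k) else 0 := by
    intro x c
    rw [← multiplexed_one k, multiplexed_apply, Pi.one_apply, Function.update_self]
    exact if_congr (forall₂_congr fun j hj => by rw [Function.update_of_ne hj]) rfl rfl
  have hne : Function.update b k 1 ≠ Function.update b k 0 := fun h => by
    simpa using congrFun h k
  ext r c
  by_cases h : ∀ j, j ≠ k → r j = b j
  · obtain ⟨x, rfl⟩ : ∃ x, r = Function.update b k x :=
      ⟨r k, Function.eq_update_iff.mpr ⟨rfl, h⟩⟩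
    have hctrl : ∀ j ∈ Finset.univ.erase k, Function.update b k 0 j = b j := fun j hj =>
      Function.update_of_ne (Finset.ne_of_mem_erase hj) _ _
    have hc : (∀ j, j ≠ k → c j = Function.update b k x j) ↔ ∀ j, j ≠ k → c j = b j :=
      forall₂_congr fun j hj => by rw [Function.update_of_ne hj]
    rw [multiplexed_apply, Function.update_idem, if_pos hctrl, Function.update_self]
    simp only [hc, givens, Matrix.of_apply, hone]
    generalize c k = y
    split_ifs <;> rcases Fin.exists_fin_two.mp ⟨x, rfl⟩ with rfl | rfl <;>
      rcases Fin.exists_fin_two.mp ⟨y, rfl⟩ with rfl | rfl <;>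
      simp_all [planeRotation]
  · have hr : ∀ x, r ≠ Function.update b k x := fun x hx =>
      h (Function.eq_update_iff.mp hx).2
    have hctrl : ¬ ∀ j ∈ Finset.univ.erase k, Function.update r k 0 j = b j := fun h' =>
      h fun j hj => by simpa [hj] using h' j (by simp [hj])
    rw [multiplexed_apply, if_neg hctrl]
    simp only [givens, Matrix.of_apply, if_neg (hr _)]
    rw [← multiplexed_one k, multiplexed_apply, Pi.one_apply]

theorem rotationConnected_update (b : Fin N → Fin 2) (k : Fin N) (x : Fin 2) :
    RotationConnected (circuits N) b (Function.update b k x) := by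
  have h01 : RotationConnected (circuits N) (Function.update b k 0) (Function.update b k 1) :=
    fun _ θ => multiplexed_eq_givens k b θ ▸
      controlled_rotation_mem_circuits k b _ (Finset.notMem_erase k _) θ
  have hall : ∀ y z : Fin 2,
      RotationConnected (circuits N) (Function.update b k y) (Function.update b k z) := by
    intro y z
    fin_cases y <;> fin_cases z
    · exact fun h => absurd rfl h
    · exact h01
    · exact h01.symm
    · exact fun h => absurd rfl h
  simpa using hall (b k) x

theorem rotationConnected_circuits (b c : Fin N → Fin 2) :
    RotationConnected (circuits N) b c := by
  suffices H : ∀ T : Finset (Fin N), RotationConnected (circuits N) b (T.piecewise c b) by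
    simpa using H Finset.univ
  intro T
  induction T using Finset.induction_on with
  | empty => exact fun h => absurd (Finset.piecewise_empty c b).symm h
  | insert j T _ ih =>
    rw [Finset.piecewise_insert]
    exact ih.trans (rotationConnected_update _ j _)

end Gates

/-- (Universality of C-NOT with local gates for real quantum theory)  For `N ≥ 2`, the
subgroup of `O(2^N)` generated by the embedded C-NOT gates and the local one-rebit orthogonal
gates contains every orthogonal matrix of determinant `1`, i.e. all of `SO(2^N)`. -/
theorem cnot_universal_RQT (N : ℕ) (hN : 2 ≤ N) :
    ∀ A : Matrix.orthogonalGroup (Fin N → Fin 2) ℝ,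
      (A : Matrix (Fin N → Fin 2) (Fin N → Fin 2) ℝ).det = 1 →
      A ∈ Subgroup.closure (gateSet N) := by
  intro A hdet
  obtain ⟨B, hB, hBA⟩ := mem_of_givens_mem (circuits N)
    (fun b c hbc => rotationConnected_circuits b c hbc) A.2 hdet
  rwa [← Subtype.ext hBA]
end
end

section
/- (Determinant obstruction in real quantum theory) Fix N ≥ 3 and let G be the subgroup of the orthogonal group O(2^N) generated by all embedded C-NOT gates V_{jk} (1 ≤ j ≠ k ≤ N) together with all local one-rebit orthogonal gates. Then every element of G has determinant +1; in particular no gate of determinant −1 on N rebits can be constructed from C-NOTs and local gates. -/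
open Matrix

noncomputable section

theorem mul_cnot_apply {N : ℕ} (A : Matrix (Fin N → Fin 2) (Fin N → Fin 2) ℝ) (j k : Fin N)
    (r c : Fin N → Fin 2) :
    (A * cnot j k) r c = A r (Function.update c k (c j + c k)) := by
  simp [Matrix.mul_apply, cnot]

theorem cnot_mul_self {N : ℕ} {j k : Fin N} (hjk : j ≠ k) : cnot j k * cnot j k = 1 := by
  ext r c
  rw [mul_cnot_apply, cnot, Matrix.of_apply, Matrix.one_apply]
  have h : ∀ a b : Fin 2, a + (a + b) = b := by decide
  simp [hjk, h]

/-- A C-NOT is a commutator of two C-NOTs through an intermediate rebit. -/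
theorem cnot_eq_commutator {N : ℕ} {j k l : Fin N} (hjk : j ≠ k) (hjl : j ≠ l) (hlk : l ≠ k) :
    cnot l k * cnot j l * cnot l k * cnot j l = cnot j k := by
  have h : ∀ a b : Fin 2, a + (a + b) = b := by decide
  have h' : ∀ a b d : Fin 2, b + (a + b + d) = a + d := by decide
  ext r c
  rw [mul_cnot_apply, mul_cnot_apply, mul_cnot_apply, cnot, cnot, Matrix.of_apply, Matrix.of_apply]
  congr 2
  ext i
  by_cases hik : i = k
  · subst hik
    simp [hjk, hjl, hlk, hlk.symm, h, h']
  · by_cases hil : i = l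
    · subst hil
      simp [hjk, hjl, hlk, hlk.symm, h]
    · simp [hik, hil]

theorem det_cnot {N : ℕ} (hN : 3 ≤ N) {j k : Fin N} (hjk : j ≠ k) : (cnot j k).det = 1 := by
  obtain ⟨l, hl⟩ := Finset.exists_mem_notMem_of_card_lt_card (s := {j, k}) (t := Finset.univ)
    (by rw [Finset.card_univ, Fintype.card_fin]; exact Finset.card_le_two.trans_lt hN)
  obtain ⟨hlj, hlk⟩ : l ≠ j ∧ l ≠ k := by simpa using hl
  have h₁ : (cnot l k).det * (cnot l k).det = 1 := by
    rw [← Matrix.det_mul, cnot_mul_self hlk, Matrix.det_one]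
  have h₂ : (cnot j l).det * (cnot j l).det = 1 := by
    rw [← Matrix.det_mul, cnot_mul_self hlj.symm, Matrix.det_one]
  rw [← cnot_eq_commutator hjk hlj.symm hlk]
  simp only [Matrix.det_mul]
  linear_combination h₁ * (cnot j l).det * (cnot j l).det + h₂

open scoped Kronecker in
theorem localGate_eq_submatrix {N : ℕ} (k : Fin N) (R : Matrix (Fin 2) (Fin 2) ℝ) :
    localGate k R =
      (R ⊗ₖ (1 : Matrix ({j // j ≠ k} → Fin 2) ({j // j ≠ k} → Fin 2) ℝ)).submatrix
        (Equiv.funSplitAt k (Fin 2)) (Equiv.funSplitAt k (Fin 2)) := by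
  ext r c
  rw [localGate, tensorString, Matrix.of_apply, Fintype.prod_eq_mul_prod_subtype_ne _ k]
  simp only [if_true, Matrix.submatrix_apply, Matrix.kroneckerMap_apply, Equiv.funSplitAt_apply]
  congr 1
  have h : ∀ i : {j // j ≠ k}, (if (i : Fin N) = k then R else 1) = 1 := fun i => if_neg i.2
  simp only [h, Matrix.one_apply, Fintype.prod_boole, funext_iff]

theorem det_localGate {N : ℕ} (k : Fin N) (R : Matrix (Fin 2) (Fin 2) ℝ) :
    (localGate k R).det = R.det ^ 2 ^ (N - 1) := by
  rw [localGate_eq_submatrix, Matrix.det_submatrix_equiv_self, Matrix.det_kronecker]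
  simp

theorem det_localGate_of_mem_orthogonalGroup {N : ℕ} (hN : 2 ≤ N) (k : Fin N)
    {R : Matrix (Fin 2) (Fin 2) ℝ} (hR : R ∈ Matrix.orthogonalGroup (Fin 2) ℝ) :
    (localGate k R).det = 1 := by
  have h : R.det ^ 2 = 1 := by
    have h := congrArg Matrix.det ((Matrix.mem_orthogonalGroup_iff (Fin 2) ℝ).mp hR)
    simpa [Matrix.star_eq_conjTranspose, sq] using h
  obtain ⟨m, rfl⟩ := Nat.exists_eq_add_of_le hN
  rw [det_localGate, show 2 + m - 1 = m + 1 by lia, pow_succ', pow_mul, h, one_pow]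

/-- (Determinant obstruction in real quantum theory)  For `N ≥ 3`, every element of the
subgroup of `O(2^N)` generated by the embedded C-NOT gates and the local one-rebit orthogonal
gates has determinant `+1`; in particular no gate of determinant `−1` on `N` rebits can be
constructed from C-NOTs and local gates. -/
theorem det_one_obstruction_RQT (N : ℕ) (hN : 3 ≤ N) :
    ∀ W ∈ Subgroup.closure (gateSet N),
      (W : Matrix (Fin N → Fin 2) (Fin N → Fin 2) ℝ).det = 1 := by
  intro W hW
  induction hW using Subgroup.closure_induction with
  | mem W hW =>
    rcases hW with ⟨j, k, hjk, h⟩ | ⟨k, R, hR, h⟩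
    · rw [h, det_cnot hN hjk]
    · rw [h, det_localGate_of_mem_orthogonalGroup (by lia) k hR]
  | one => simp
  | mul A B _ _ hA hB => simp [hA, hB]
  | inv A _ hA => simp [Matrix.star_eq_conjTranspose, hA]
end
end

section
/- (Weak universality of C-NOT for real quantum theory) Fix N ≥ 2 and let S be any 2^N × 2^N real orthogonal matrix (including those with determinant −1). Then the matrix I₂ ⊗ S, where I₂ is the 2×2 identity, has determinant +1 and belongs to the subgroup of O(2^{N+1}) generated by all embedded C-NOT gates V_{jk} (1 ≤ j ≠ k ≤ N+1) together with all local one-rebit orthogonal gates on N+1 rebits. Hence every reversible transformation of N rebits can be realized with C-NOTs and local gates at the cost of one additional ancillary rebit. -/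
open Matrix

noncomputable section

/-- The Kronecker product `I₂ ⊗ S` on `N+1` rebits, under the identification
`ℝ^{2^{N+1}} ≅ ℝ² ⊗ ℝ^{2^N}` in which the first bit labels the ancillary rebit. -/
def ancilla {N : ℕ} (S : Matrix (Fin N → Fin 2) (Fin N → Fin 2) ℝ) :
    Matrix (Fin (N + 1) → Fin 2) (Fin (N + 1) → Fin 2) ℝ :=
  Matrix.of fun r c =>
    (if r 0 = c 0 then 1 else 0) * S (fun i => r i.succ) (fun i => c i.succ)

section Mirror

variable {ι : Type*} [Fintype ι] [DecidableEq ι]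

/-- The reflection in the hyperplane orthogonal to `w`; it is the identity for `w = 0`. -/
def mirror (w : ι → ℝ) : Matrix ι ι ℝ :=
  1 - (2 / (w ⬝ᵥ w)) • vecMulVec w w

theorem mirror_mulVec (w v : ι → ℝ) :
    mirror w *ᵥ v = v - (2 * (w ⬝ᵥ v) / (w ⬝ᵥ w)) • w := by
  ext i
  simp [mirror, sub_mulVec, smul_mulVec, vecMulVec_mulVec]
  ring

theorem mirror_transpose (w : ι → ℝ) : (mirror w)ᵀ = mirror w := by
  simp [mirror, transpose_vecMulVec]

theorem mirror_mul_self (w : ι → ℝ) : mirror w * mirror w = 1 := by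
  by_cases hw : w = 0
  · simp [mirror, hw]
  have h : w ⬝ᵥ w ≠ 0 := by simpa using hw
  simp only [mirror, sub_mul, mul_sub, one_mul, mul_one, smul_mul_assoc, mul_smul_comm,
    vecMulVec_mul_vecMulVec, vecMulVec_smul, smul_smul]
  ext i j
  simp
  field_simp
  ring

theorem mirror_mem_orthogonalGroup (w : ι → ℝ) : mirror w ∈ orthogonalGroup ι ℝ := by
  rw [mem_orthogonalGroup_iff, mirror_transpose, mirror_mul_self]

theorem mirror_sub_mulVec {w v : ι → ℝ} (h : w ⬝ᵥ w = v ⬝ᵥ v) : mirror (w - v) *ᵥ w = v := by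
  by_cases hw : w - v = 0
  · simp [mirror, sub_eq_zero.1 hw]
  have h0 : (w - v) ⬝ᵥ (w - v) ≠ 0 := dotProduct_self_eq_zero.not.2 hw
  have h1 : 2 * ((w - v) ⬝ᵥ w) = (w - v) ⬝ᵥ (w - v) := by
    simp only [sub_dotProduct, dotProduct_sub, dotProduct_comm v w]
    linarith
  rw [mirror_mulVec, h1, div_self h0]
  simp

theorem mirror_mul_mirror_mul_mirror {w v : ι → ℝ} (h : w ⬝ᵥ w = v ⬝ᵥ v) :
    mirror (w - v) * mirror w * mirror (w - v) = mirror v := by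
  conv_lhs => rw [mirror.eq_def w]
  rw [mul_sub, sub_mul, mul_one, mirror_mul_self, mul_smul_comm, smul_mul_assoc, mul_vecMulVec,
    vecMulVec_mul, ← mulVec_transpose, mirror_transpose, mirror_sub_mulVec h, h, mirror]

/-- Hyperplane reflections generate the orthogonal group. -/
theorem orthogonalGroup_le_of_mirror_mem {P : Submonoid (Matrix ι ι ℝ)}
    (hP : ∀ w, mirror w ∈ P) : orthogonalGroup ι ℝ ≤ P := by
  suffices H : ∀ (s : Finset ι) (A : Matrix ι ι ℝ), A ∈ orthogonalGroup ι ℝ →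
      (∀ x ∉ s, A *ᵥ Pi.single x 1 = Pi.single x 1) → A ∈ P from
    fun A hA => H Finset.univ A hA (by simp)
  intro s
  induction s using Finset.induction_on with
  | empty =>
    intro A _ h
    have : A = 1 := by
      ext i j
      have := congrFun (h j (by simp)) i
      rw [mulVec_single_one] at this
      simpa [Matrix.one_apply, Pi.single_apply] using this
    exact this ▸ P.one_mem
  | insert y s hy ih =>
    intro A hA h
    have hdot : ∀ u v : ι → ℝ, (A *ᵥ u) ⬝ᵥ (A *ᵥ v) = u ⬝ᵥ v := by
      intro u v
      have : Aᵀ * A = 1 := (mem_orthogonalGroup_iff' ι ℝ).1 hA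
      rw [dotProduct_mulVec, ← mulVec_transpose, mulVec_mulVec, this, one_mulVec]
    set u : ι → ℝ := A *ᵥ Pi.single y 1 - Pi.single y 1 with hu
    have hB : mirror u * A ∈ P := by
      refine ih _ (mul_mem (mirror_mem_orthogonalGroup u) hA) fun x hx => ?_
      rw [← mulVec_mulVec]
      by_cases hxy : x = y
      · subst hxy
        exact mirror_sub_mulVec (hdot _ _)
      · have hx' := h x (by simp [hx, hxy])
        have h0 : u ⬝ᵥ Pi.single x 1 = 0 := by
          rw [hu, sub_dotProduct]
          conv_lhs => enter [1]; rw [← hx']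
          rw [hdot, sub_self]
        rw [hx', mirror_mulVec, h0]
        simp
    have := P.mul_mem (hP u) hB
    rwa [← mul_assoc, mirror_mul_self, one_mul] at this

theorem mirror_mem_of_sub {P : Submonoid (Matrix ι ι ℝ)} {w v : ι → ℝ}
    (h : w ⬝ᵥ w = v ⬝ᵥ v) (hwv : mirror (w - v) ∈ P) (hv : mirror v ∈ P) : mirror w ∈ P := by
  have := P.mul_mem (P.mul_mem hwv hv) hwv
  rwa [← mirror_mul_mirror_mul_mirror h, ← mul_assoc, ← mul_assoc, mirror_mul_self, one_mul,
    mul_assoc, mirror_mul_self, mul_one] at this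

/-- The submonoid `P` contains all reflections in vectors supported on `{x, y}`. -/
def ContainsMirrors (P : Submonoid (Matrix ι ι ℝ)) (x y : ι) : Prop :=
  ∀ a b : ℝ, mirror (Pi.single x a + Pi.single y b) ∈ P

theorem ContainsMirrors.trans {P : Submonoid (Matrix ι ι ℝ)} {x y z : ι}
    (hxy : ContainsMirrors P x y) (hyz : ContainsMirrors P y z) : ContainsMirrors P x z := by
  intro a b
  by_cases h1 : x = z
  · subst h1
    have := hxy (a + b) 0
    rwa [Pi.single_zero, add_zero, Pi.single_add] at this
  by_cases h2 : x = y
  · subst h2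
    exact hyz a b
  have hdot : (Pi.single x a + Pi.single z b : ι → ℝ) ⬝ᵥ (Pi.single x a + Pi.single z b) =
      (Pi.single x a + Pi.single y b) ⬝ᵥ (Pi.single x a + Pi.single y b) := by
    simp [h1, h2, Ne.symm h1, Ne.symm h2]
  have hsub : (Pi.single x a + Pi.single z b - (Pi.single x a + Pi.single y b) : ι → ℝ) =
      Pi.single y (-b) + Pi.single z b := by
    rw [Pi.single_neg]
    abel
  exact mirror_mem_of_sub hdot (hsub ▸ hyz (-b) b) (hxy a b)

theorem mirror_mem_of_containsMirrors {P : Submonoid (Matrix ι ι ℝ)}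
    (hP : ∀ x y, ContainsMirrors P x y) (w : ι → ℝ) : mirror w ∈ P := by
  by_cases hw : w = 0
  · simp [hw, mirror]
  obtain ⟨y, -⟩ := Function.ne_iff.1 hw
  suffices H : ∀ (s : Finset ι) (w : ι → ℝ), (∀ x ∉ s, x ≠ y → w x = 0) → mirror w ∈ P from
    H Finset.univ w (by simp)
  intro s
  induction s using Finset.induction_on with
  | empty =>
    intro w h
    convert hP y y (w y) 0
    ext x
    by_cases hx : x = y
    · simp [hx]
    · simp [hx, h x]
  | insert z s hz ih =>
    intro w h
    by_cases hzy : z = y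
    · refine ih w fun x hx hxy => h x ?_ hxy
      simp [hx, hzy, hxy]
    set c := √(w y ^ 2 + w z ^ 2)
    have hc : c * c = w y ^ 2 + w z ^ 2 := Real.mul_self_sqrt (by positivity)
    set v := w - (Pi.single y (w y - c) + Pi.single z (w z)) with hv
    have hwv : w - v = Pi.single y (w y - c) + Pi.single z (w z) := by simp [hv]
    refine mirror_mem_of_sub (v := v) ?_ (hwv ▸ hP _ _ _ _) (ih v fun x hx hxy => ?_)
    · simp [hv, hzy, Ne.symm hzy]
      linarith
    · by_cases hxz : x = z
      · simp [hv, hxz, hzy]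
      · simpa [hv, hxz, hxy] using h x (by simp [hx, hxz]) hxy

end Mirror

section Gates

variable {n : ℕ}

/-- The uniformly controlled gate applying `F b` to rebit `k`, where `b` is the string of the
remaining bits. -/
def blockGate (k : Fin n) (F : ({j // j ≠ k} → Fin 2) → Matrix (Fin 2) (Fin 2) ℝ) :
    Matrix (Fin n → Fin 2) (Fin n → Fin 2) ℝ :=
  (blockDiagonal F).submatrix (Equiv.funSplitAt k (Fin 2)) (Equiv.funSplitAt k (Fin 2))

theorem blockGate_apply (k : Fin n) (F : ({j // j ≠ k} → Fin 2) → Matrix (Fin 2) (Fin 2) ℝ)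
    (r c : Fin n → Fin 2) :
    blockGate k F r c =
      if ∀ j, j ≠ k → r j = c j then F (fun j => r j) (r k) (c k) else 0 := by
  simp [blockGate, blockDiagonal_apply, funext_iff]

theorem blockGate_mul (k : Fin n) (F G : ({j // j ≠ k} → Fin 2) → Matrix (Fin 2) (Fin 2) ℝ) :
    blockGate k F * blockGate k G = blockGate k fun b => F b * G b := by
  simp [blockGate, submatrix_mul_equiv, blockDiagonal_mul]

theorem blockGate_one (k : Fin n) : blockGate k (fun _ => 1) = 1 := by
  have : (fun _ => 1 : ({j // j ≠ k} → Fin 2) → Matrix (Fin 2) (Fin 2) ℝ) = 1 := rfl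
  rw [blockGate, this, blockDiagonal_one, submatrix_one_equiv]

theorem blockGate_transpose (k : Fin n)
    (F : ({j // j ≠ k} → Fin 2) → Matrix (Fin 2) (Fin 2) ℝ) :
    (blockGate k F)ᵀ = blockGate k fun b => (F b)ᵀ := by
  simp [blockGate, transpose_submatrix, blockDiagonal_transpose]

theorem blockGate_mem_orthogonalGroup {k : Fin n}
    {F : ({j // j ≠ k} → Fin 2) → Matrix (Fin 2) (Fin 2) ℝ}
    (hF : ∀ b, F b ∈ orthogonalGroup (Fin 2) ℝ) :
    blockGate k F ∈ orthogonalGroup (Fin n → Fin 2) ℝ := by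
  rw [mem_orthogonalGroup_iff, blockGate_transpose, blockGate_mul, ← blockGate_one k]
  congr! 2 with b
  exact (mem_orthogonalGroup_iff _ _).1 (hF b)

theorem localGate_eq_blockGate (k : Fin n) (R : Matrix (Fin 2) (Fin 2) ℝ) :
    localGate k R = blockGate k fun _ => R := by
  ext r c
  rw [blockGate_apply, localGate, tensorString, of_apply,
    ← Finset.mul_prod_erase _ _ (Finset.mem_univ k), if_pos rfl]
  have : ∏ j ∈ Finset.univ.erase k, (if j = k then R else 1) (r j) (c j) =
      ∏ j ∈ Finset.univ.erase k, if r j = c j then (1 : ℝ) else 0 :=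
    Finset.prod_congr rfl fun j hj => by rw [if_neg (Finset.ne_of_mem_erase hj), one_apply]
  rw [this, Finset.prod_ite_zero]
  simp

/-- The `2 × 2` bit flip. -/
def bitFlip : Matrix (Fin 2) (Fin 2) ℝ := !![0, 1; 1, 0]

theorem bitFlip_mul_self : bitFlip * bitFlip = 1 := by
  ext i j
  fin_cases i <;> fin_cases j <;> simp [bitFlip]

theorem bitFlip_mem_orthogonalGroup : bitFlip ∈ orthogonalGroup (Fin 2) ℝ := by
  have : bitFlipᵀ = bitFlip := by
    ext i j
    fin_cases i <;> fin_cases j <;> simp [bitFlip]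
  rw [mem_orthogonalGroup_iff, this, bitFlip_mul_self]

theorem cnot_eq_blockGate {j k : Fin n} (h : j ≠ k) :
    cnot j k = blockGate k fun b => if b ⟨j, h⟩ = 1 then bitFlip else 1 := by
  ext r c
  rw [blockGate_apply, cnot, of_apply]
  have : r = Function.update c k (c j + c k) ↔ (∀ i, i ≠ k → r i = c i) ∧ r k = c j + c k := by
    constructor
    · rintro rfl
      simp +contextual
    · rintro ⟨h1, h2⟩
      ext i : 1
      by_cases hi : i = k
      · simp [hi, h2]
      · simp [hi, h1 i hi]
  simp only [this]
  by_cases h1 : ∀ i, i ≠ k → r i = c i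
  · simp only [if_pos h1, h1 j h, and_iff_right h1]
    generalize c j = p
    generalize r k = q
    generalize c k = s
    fin_cases p <;> fin_cases q <;> fin_cases s <;> simp [bitFlip]
  · rw [if_neg h1, if_neg fun h => h1 h.1]

/-- The matrices realized by circuits of C-NOTs and local gates. -/
def realizable (n : ℕ) : Submonoid (Matrix (Fin n → Fin 2) (Fin n → Fin 2) ℝ) :=
  (Subgroup.closure (gateSet n)).toSubmonoid.map
    (orthogonalGroup (Fin n → Fin 2) ℝ).subtype

theorem localGate_mem_realizable (k : Fin n) {R : Matrix (Fin 2) (Fin 2) ℝ}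
    (hR : R ∈ orthogonalGroup (Fin 2) ℝ) : blockGate k (fun _ => R) ∈ realizable n :=
  ⟨⟨_, blockGate_mem_orthogonalGroup fun _ => hR⟩,
    Subgroup.subset_closure (Or.inr ⟨k, R, hR, (localGate_eq_blockGate k R).symm⟩), rfl⟩

theorem controlledFlip_mem_realizable {j k : Fin n} (h : j ≠ k) (t : Fin 2) :
    blockGate k (fun b => if b ⟨j, h⟩ = t then bitFlip else 1) ∈ realizable n := by
  have h1 : blockGate k (fun b => if b ⟨j, h⟩ = 1 then bitFlip else 1) ∈ realizable n := by
    refine ⟨⟨_, blockGate_mem_orthogonalGroup fun b => ?_⟩,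
      Subgroup.subset_closure (Or.inl ⟨j, k, h, (cnot_eq_blockGate h).symm⟩), rfl⟩
    split_ifs
    exacts [bitFlip_mem_orthogonalGroup, one_mem _]
  fin_cases t
  · have := mul_mem h1 (localGate_mem_realizable k bitFlip_mem_orthogonalGroup)
    rw [blockGate_mul] at this
    convert this using 3 with b
    generalize b ⟨j, h⟩ = p
    fin_cases p <;> simp [bitFlip_mul_self]
  · exact h1

/-- The `2 × 2` rotation by the angle `θ`. -/
def rot (θ : ℝ) : Matrix (Fin 2) (Fin 2) ℝ :=
  !![Real.cos θ, -Real.sin θ; Real.sin θ, Real.cos θ]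

theorem rot_mul (θ φ : ℝ) : rot θ * rot φ = rot (θ + φ) := by
  ext i j
  fin_cases i <;> fin_cases j <;> simp [rot, Real.cos_add, Real.sin_add] <;> ring

theorem rot_zero : rot 0 = 1 := by
  ext i j
  fin_cases i <;> fin_cases j <;> simp [rot]

theorem rot_pi : rot Real.pi = -1 := by
  ext i j
  fin_cases i <;> fin_cases j <;> simp [rot]

theorem rot_mem_orthogonalGroup (θ : ℝ) : rot θ ∈ orthogonalGroup (Fin 2) ℝ := by
  have : (rot θ)ᵀ = rot (-θ) := by
    ext i j
    fin_cases i <;> fin_cases j <;> simp [rot]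
  rw [mem_orthogonalGroup_iff, this, rot_mul, add_neg_cancel, rot_zero]

theorem bitFlip_mul_rot_mul_bitFlip (θ : ℝ) : bitFlip * rot θ * bitFlip = rot (-θ) := by
  ext i j
  fin_cases i <;> fin_cases j <;> simp [rot, bitFlip, mul_apply]

/-- The gate applying `R` to rebit `k` if the bits in `T`, other than `k`, agree with `x`. -/
def ctrlGate (k : Fin n) (T : Finset (Fin n)) (x : Fin n → Fin 2)
    (R : Matrix (Fin 2) (Fin 2) ℝ) : Matrix (Fin n → Fin 2) (Fin n → Fin 2) ℝ :=
  blockGate k fun b => if ∀ j : {j // j ≠ k}, j.1 ∈ T → b j = x j then R else 1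

theorem ctrlGate_mul (k : Fin n) (T : Finset (Fin n)) (x : Fin n → Fin 2)
    (R R' : Matrix (Fin 2) (Fin 2) ℝ) :
    ctrlGate k T x R * ctrlGate k T x R' = ctrlGate k T x (R * R') := by
  rw [ctrlGate, ctrlGate, blockGate_mul, ctrlGate]
  congr! 2 with b
  split_ifs <;> simp

theorem ctrlGate_apply (k : Fin n) (T : Finset (Fin n)) (x : Fin n → Fin 2)
    (R : Matrix (Fin 2) (Fin 2) ℝ) (r c : Fin n → Fin 2) :
    ctrlGate k T x R r c = if ∀ j, j ≠ k → r j = c j then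
      if ∀ j, j ≠ k → j ∈ T → r j = x j then R (r k) (c k) else if r k = c k then 1 else 0
      else 0 := by
  simp only [ctrlGate, blockGate_apply, Subtype.forall]
  split_ifs <;> simp_all [one_apply]

theorem ctrlGate_rot_mem_realizable (k : Fin n) (T : Finset (Fin n)) (x : Fin n → Fin 2)
    (θ : ℝ) : ctrlGate k T x (rot θ) ∈ realizable n := by
  induction T using Finset.induction_on generalizing θ with
  | empty => simpa [ctrlGate] using localGate_mem_realizable k (rot_mem_orthogonalGroup θ)
  | insert j T _ ih =>
    by_cases hj : j = k
    · convert ih θ using 1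
      simp only [ctrlGate]
      congr! 4 with b i
      simp [hj, i.2]
    have hX := controlledFlip_mem_realizable hj (x j)
    have := mul_mem (ih (θ / 2)) (mul_mem (mul_mem hX (ih (-(θ / 2)))) hX)
    simp only [ctrlGate, blockGate_mul] at this ⊢
    convert this using 3 with b
    have h1 : (∀ i : {i // i ≠ k}, i.1 ∈ insert j T → b i = x i) ↔
        b ⟨j, hj⟩ = x j ∧ ∀ i : {i // i ≠ k}, i.1 ∈ T → b i = x i := by
      simp only [Finset.mem_insert]
      constructor
      · exact fun h => ⟨h ⟨j, hj⟩ (Or.inl rfl), fun i hi => h i (Or.inr hi)⟩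
      · rintro ⟨h1, h2⟩ ⟨i, hi⟩ (rfl | h)
        exacts [h1, h2 _ h]
    simp only [h1]
    by_cases h2 : b ⟨j, hj⟩ = x j <;>
      by_cases h3 : ∀ i : {i // i ≠ k}, i.1 ∈ T → b i = x i
    · simp only [if_pos h2, if_pos h3, if_pos (And.intro h2 h3), bitFlip_mul_rot_mul_bitFlip,
        rot_mul, neg_neg, add_halves]
    · simp only [if_pos h2, if_neg h3, if_neg fun h : _ ∧ _ => h3 h.2, mul_one, bitFlip_mul_self]
    · simp only [if_neg h2, if_pos h3, if_neg fun h : _ ∧ _ => h2 h.1, one_mul, mul_one, rot_mul,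
        add_neg_cancel, rot_zero]
    · simp only [if_neg h2, if_neg h3, if_neg fun h : _ ∧ _ => h2 h.1, mul_one]

/-- The `2 × 2` phase flip. -/
def phaseFlip : Matrix (Fin 2) (Fin 2) ℝ := !![1, 0; 0, -1]

theorem ctrlGate_phaseFlip_eq {k l : Fin n} (hlk : l ≠ k) {T : Finset (Fin n)} (hl : l ∉ T)
    (x : Fin n → Fin 2) :
    ctrlGate k T x phaseFlip =
      ctrlGate l (insert k T) (Function.update x k 1) (rot Real.pi) := by
  have key : ∀ (m : Fin n) (P : Prop) [Decidable P] (d : Fin 2 → ℝ) (r c : Fin n → Fin 2),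
      (if ∀ j, j ≠ m → r j = c j then
        if P then diagonal d (r m) (c m) else if r m = c m then 1 else 0 else 0) =
        if r = c then (if P then d (r m) else 1) else 0 := by
    intro m P _ d r c
    by_cases h : r = c
    · subst h
      simp
    · by_cases h1 : ∀ j, j ≠ m → r j = c j
      · have h2 : r m ≠ c m := fun h2 => h (funext fun j => by
          by_cases hj : j = m
          exacts [hj ▸ h2, h1 j hj])
        rw [if_pos h1, if_neg h]
        simp [h2]
      · rw [if_neg h1, if_neg h]
  have hZ : phaseFlip = diagonal ![1, -1] := by
    ext i j
    fin_cases i <;> fin_cases j <;> simp [phaseFlip]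
  have hR : rot Real.pi = diagonal fun _ => -1 := by
    rw [rot_pi, ← diagonal_one, diagonal_neg]
  ext r c
  rw [ctrlGate_apply, ctrlGate_apply, hZ, hR, key k, key l]
  congr 1
  have h1 : (∀ j, j ≠ l → j ∈ insert k T → r j = Function.update x k 1 j) ↔
      r k = 1 ∧ ∀ j, j ≠ k → j ∈ T → r j = x j := by
    constructor
    · intro h
      refine ⟨by simpa using h k hlk.symm (by simp), fun j hj hT => ?_⟩
      simpa [hj] using h j (fun e => hl (e ▸ hT)) (by simp [hT])
    · rintro ⟨h1, h2⟩ j - hT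
      by_cases hj : j = k
      · simp [hj, h1]
      · simpa [hj] using h2 j hj (by simpa [hj] using hT)
  simp only [h1]
  generalize r k = p
  fin_cases p <;> simp

theorem ctrlGate_phaseFlip_mem_realizable {k l : Fin n} (hlk : l ≠ k) {T : Finset (Fin n)}
    (hl : l ∉ T) (x : Fin n → Fin 2) :
    ctrlGate k T x phaseFlip ∈ realizable n :=
  ctrlGate_phaseFlip_eq hlk hl x ▸ ctrlGate_rot_mem_realizable _ _ _ _

end Gates

section Ancilla

variable {N : ℕ}

theorem ancilla_eq_submatrix (S : Matrix (Fin N → Fin 2) (Fin N → Fin 2) ℝ) :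
    ancilla S = (blockDiagonal fun _ : Fin 2 => S).submatrix
      ((Fin.consEquiv fun _ => Fin 2).symm.trans (Equiv.prodComm _ _))
      ((Fin.consEquiv fun _ => Fin 2).symm.trans (Equiv.prodComm _ _)) := by
  ext r c
  simp [ancilla, blockDiagonal_apply, Fin.consEquiv, Fin.tail_def]

theorem ancilla_one : ancilla (1 : Matrix (Fin N → Fin 2) (Fin N → Fin 2) ℝ) = 1 := by
  have : (fun _ : Fin 2 => (1 : Matrix (Fin N → Fin 2) (Fin N → Fin 2) ℝ)) = 1 := rfl
  rw [ancilla_eq_submatrix, this, blockDiagonal_one, submatrix_one_equiv]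

theorem ancilla_mul (A B : Matrix (Fin N → Fin 2) (Fin N → Fin 2) ℝ) :
    ancilla (A * B) = ancilla A * ancilla B := by
  simp only [ancilla_eq_submatrix, submatrix_mul_equiv, blockDiagonal_mul]

theorem det_ancilla (S : Matrix (Fin N → Fin 2) (Fin N → Fin 2) ℝ) :
    (ancilla S).det = S.det ^ 2 := by
  rw [ancilla_eq_submatrix, det_submatrix_equiv_self, det_blockDiagonal]
  simp

/-- The matrices realized by C-NOTs and local gates with the help of one ancillary rebit. -/
def ancillaRealizable (N : ℕ) : Submonoid (Matrix (Fin N → Fin 2) (Fin N → Fin 2) ℝ) :=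
  (realizable (N + 1)).comap
    (⟨⟨ancilla, ancilla_one⟩, ancilla_mul⟩ :
      Matrix (Fin N → Fin 2) (Fin N → Fin 2) ℝ →* Matrix (Fin (N + 1) → Fin 2) _ ℝ)

theorem ancilla_ctrlGate (k : Fin N) (T : Finset (Fin N)) (x : Fin N → Fin 2)
    (R : Matrix (Fin 2) (Fin 2) ℝ) :
    ancilla (ctrlGate k T x R) =
      ctrlGate k.succ (T.map (Fin.succEmb N)) (Fin.cons 0 x) R := by
  ext r c
  rw [ancilla, of_apply, ctrlGate_apply, ctrlGate_apply]
  simp only [Fin.forall_fin_succ (n := N)]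
  simp [ite_and, (Fin.succ_ne_zero k).symm]
  split_ifs <;> rfl

theorem exists_mirror_eq (u : Fin 2 → ℝ) :
    ∃ θ, mirror u = rot θ ∨ mirror u = rot θ * phaseFlip := by
  by_cases hu : u = 0
  · exact ⟨0, Or.inl (by simp [hu, mirror, rot_zero])⟩
  have h0 : u ⬝ᵥ u ≠ 0 := dotProduct_self_eq_zero.not.2 hu
  have h1 : u ⬝ᵥ u = u 0 * u 0 + u 1 * u 1 := by simp [dotProduct]
  rw [h1] at h0
  set d := u 0 * u 0 + u 1 * u 1 with hd
  obtain ⟨θ, hθ⟩ := (Complex.norm_eq_one_iff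
    ⟨(u 1 * u 1 - u 0 * u 0) / d, -(2 * u 0 * u 1) / d⟩).1 (by
      rw [← sq_eq_sq₀ (norm_nonneg _) zero_le_one, Complex.sq_norm, Complex.normSq_mk]
      field_simp
      rw [hd]
      ring)
  have hc : Real.cos θ = (u 1 * u 1 - u 0 * u 0) / d := by
    rw [← Complex.exp_ofReal_mul_I_re, hθ]
  have hs : Real.sin θ = -(2 * u 0 * u 1) / d := by
    rw [← Complex.exp_ofReal_mul_I_im, hθ]
  refine ⟨θ, Or.inr ?_⟩
  ext i j
  fin_cases i <;> fin_cases j <;>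
    simp [mirror, rot, phaseFlip, vecMulVec_apply, hc, hs, h1] <;> field_simp <;> rw [hd] <;> ring

theorem mirror_single_add_single_update (k : Fin N) (x : Fin N → Fin 2) (t : Fin 2) (a b : ℝ) :
    mirror (Pi.single x a + Pi.single (Function.update x k t) b) =
      ctrlGate k (Finset.univ.erase k) x (mirror (Pi.single (x k) a + Pi.single t b)) := by
  set u : Fin 2 → ℝ := Pi.single (x k) a + Pi.single t b with hu
  set w : (Fin N → Fin 2) → ℝ := Pi.single x a + Pi.single (Function.update x k t) b with hw
  have hupd : x = Function.update x k t ↔ x k = t := by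
    rw [eq_comm, Function.update_eq_self_iff, eq_comm]
  have hdot : w ⬝ᵥ w = u ⬝ᵥ u := by
    simp [hw, hu, Pi.single_apply, hupd, eq_comm (a := t), eq_comm (b := x)]
  have hwr : ∀ r, w r = if ∀ j, j ≠ k → r j = x j then u (r k) else 0 := by
    intro r
    split_ifs with h
    · have : r = Function.update x k (r k) := by
        ext j : 1
        by_cases hj : j = k
        · simp [hj]
        · simp [hj, h j hj]
      have e1 : r = x ↔ r k = x k := by
        conv_lhs => rw [this]
        exact Function.update_eq_self_iff
      have e2 : r = Function.update x k t ↔ r k = t := by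
        conv_lhs => rw [this]
        exact (Function.update_injective x k).eq_iff
      simp [hw, hu, Pi.single_apply, e1, e2]
    · have e1 : r ≠ x := by
        rintro rfl
        simp at h
      have e2 : r ≠ Function.update x k t := by
        rintro rfl
        exact h fun j hj => by simp [hj]
      simp [hw, e1, e2]
  ext r c
  rw [ctrlGate_apply]
  have hT : (∀ j, j ≠ k → j ∈ Finset.univ.erase k → r j = x j) ↔ ∀ j, j ≠ k → r j = x j := by
    simp +contextual
  have hrc : r = c ↔ (∀ j, j ≠ k → r j = c j) ∧ r k = c k := by
    refine ⟨by rintro rfl; simp, fun ⟨h1, h2⟩ => funext fun j => ?_⟩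
    by_cases hj : j = k
    exacts [hj ▸ h2, h1 j hj]
  simp only [hT, mirror, Matrix.sub_apply, Matrix.smul_apply, vecMulVec_apply, hdot, hwr, one_apply, hrc]
  by_cases h1 : ∀ j, j ≠ k → r j = c j
  · have h2 : (∀ j, j ≠ k → r j = x j) ↔ ∀ j, j ≠ k → c j = x j :=
      forall₂_congr fun j hj => by rw [h1 j hj]
    rw [if_pos h1, ← if_congr h2 rfl rfl]
    split_ifs <;> simp_all
  · rw [if_neg h1]
    have h2 : ¬((∀ j, j ≠ k → r j = x j) ∧ ∀ j, j ≠ k → c j = x j) :=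
      fun ⟨h2, h3⟩ => h1 fun j hj => (h2 j hj).trans (h3 j hj).symm
    by_cases h3 : ∀ j, j ≠ k → r j = x j
    · rw [if_neg fun h4 => h2 ⟨h3, h4⟩]
      simp [h1]
    · rw [if_neg h3]
      simp [h1]

theorem containsMirrors_update (k : Fin N) (x : Fin N → Fin 2) (t : Fin 2) :
    ContainsMirrors (ancillaRealizable N) x (Function.update x k t) := by
  intro a b
  rw [mirror_single_add_single_update]
  change ancilla _ ∈ realizable (N + 1)
  rw [ancilla_ctrlGate]
  obtain ⟨θ, h | h⟩ := exists_mirror_eq (Pi.single (x k) a + Pi.single t b)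
  · exact h ▸ ctrlGate_rot_mem_realizable _ _ _ _
  · rw [h, ← ctrlGate_mul]
    exact mul_mem (ctrlGate_rot_mem_realizable _ _ _ _)
      (ctrlGate_phaseFlip_mem_realizable (l := 0) (Fin.succ_ne_zero k).symm (by simp) _)

theorem containsMirrors_ancillaRealizable [NeZero N] (x y : Fin N → Fin 2) :
    ContainsMirrors (ancillaRealizable N) x y := by
  suffices H : ∀ T : Finset (Fin N), ContainsMirrors (ancillaRealizable N) x (T.piecewise y x) by
    simpa using H Finset.univ
  intro T
  induction T using Finset.induction_on with
  | empty => simpa using containsMirrors_update 0 x (x 0)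
  | insert j T _ ih =>
    rw [Finset.piecewise_insert]
    exact ih.trans (containsMirrors_update j _ _)

theorem orthogonalGroup_le_ancillaRealizable [NeZero N] :
    orthogonalGroup (Fin N → Fin 2) ℝ ≤ ancillaRealizable N :=
  orthogonalGroup_le_of_mirror_mem
    (mirror_mem_of_containsMirrors containsMirrors_ancillaRealizable)

end Ancilla

/-- (Weak universality of C-NOT for real quantum theory)  For `N ≥ 2` and any orthogonal
`S ∈ O(2^N)` (possibly of determinant `−1`), the matrix `I₂ ⊗ S` has determinant `+1` and
belongs to the subgroup of `O(2^{N+1})` generated by the embedded C-NOT gates and the local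
one-rebit orthogonal gates on `N+1` rebits: every reversible transformation of `N` rebits is
realizable with C-NOTs and local gates at the cost of one ancillary rebit. -/
theorem cnot_weakly_universal_RQT (N : ℕ) (hN : 2 ≤ N)
    (S : Matrix (Fin N → Fin 2) (Fin N → Fin 2) ℝ)
    (hS : S ∈ Matrix.orthogonalGroup (Fin N → Fin 2) ℝ) :
    (ancilla S).det = 1 ∧
    ∃ W ∈ Subgroup.closure (gateSet (N + 1)),
      (W : Matrix (Fin (N + 1) → Fin 2) (Fin (N + 1) → Fin 2) ℝ) = ancilla S := by
  have : NeZero N := ⟨by omega⟩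
  refine ⟨?_, orthogonalGroup_le_ancillaRealizable hS⟩
  have h := congrArg det ((mem_orthogonalGroup_iff _ _).1 hS)
  rw [det_mul, det_transpose, det_one] at h
  rw [det_ancilla, sq, h]
end
end
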